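/- arXiv:1101.1576 — 2 statements merged into one kernel-verified Lean document; each statement's English description precedes it below -/
import Mathlib

section
/- Assume N ≥ 1, p > 1, f : [0,∞) → [0,∞) is locally Lipschitz continuous, nondecreasing, with f(0) = 0, f(s) > 0 for s > 0, and K := ∫_1^∞ ds/F(s)^{1/p} = ∞ where F(s) = ∫_0^s f(σ) dσ. Then for every a > 0 there exists a unique continuous function w_a : [0,∞) → ℝ satisfying the integral equation w_a(r) = a + ∫_0^r H_p( s^{1−N} ∫_0^s τ^{N−1} f(w_a(τ)) dτ ) ds for all r ≥ 0, where H_p is the inverse function of t ↦ |t|^{p−2} t; equivalently, w_a is the unique solution on [0,∞) of (r^{N−1} |w'|^{p−2} w')' = r^{N−1} f(w) with w(0) = a and w'(0) = 0. -/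
open MeasureTheory Set Filter Topology
open scoped RealInnerProductSpace ENNReal NNReal

noncomputable section

abbrev Spc (N : ℕ) := EuclideanSpace ℝ (Fin N)

/-- spatial gradient of `u (·, t)` at `x`. -/
noncomputable def sgrad {N : ℕ} (u : Spc N → ℝ → ℝ) (x : Spc N) (t : ℝ) : Spc N :=
  gradient (fun y => u y t) x

/-- weak solution of `∂ₜ u - Δ_p u + f(u) = 0` on `Ω × I`. -/
def IsWeakSolution {N : ℕ} (p : ℝ) (f : ℝ → ℝ) (Ω : Set (Spc N)) (I : Set ℝ)
    (u : Spc N → ℝ → ℝ) : Prop :=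
  MeasureTheory.LocallyIntegrableOn (fun z : Spc N × ℝ => u z.1 z.2) (Ω ×ˢ I) ∧
  MeasureTheory.LocallyIntegrableOn (fun z : Spc N × ℝ => ‖sgrad u z.1 z.2‖ ^ p) (Ω ×ˢ I) ∧
  MeasureTheory.LocallyIntegrableOn (fun z : Spc N × ℝ => f (u z.1 z.2)) (Ω ×ˢ I) ∧
  ∀ (φ : Spc N → ℝ → ℝ) (g G : ℝ → ℝ),
    ContDiff ℝ (⊤ : ℕ∞) (fun z : Spc N × ℝ => φ z.1 z.2) →
    HasCompactSupport (fun z : Spc N × ℝ => φ z.1 z.2) →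
    tsupport (fun z : Spc N × ℝ => φ z.1 z.2) ⊆ Ω ×ˢ I →
    Continuous g → (∃ L : ℝ≥0, LipschitzWith L g) →
    (∀ r : ℝ, HasDerivAt G (g r) r) →
    ∫ z : Spc N × ℝ in Ω ×ˢ I,
      (-(G (u z.1 z.2) * deriv (fun s : ℝ => φ z.1 s) z.2)
        + ‖sgrad u z.1 z.2‖ ^ (p - 2) *
            ⟪sgrad u z.1 z.2, gradient (fun y : Spc N => g (u y z.2) * φ y z.2) z.1⟫
        + f (u z.1 z.2) * g (u z.1 z.2) * φ z.1 z.2) = 0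

/-- the fundamental solution with initial data `k δ₀`. -/
def IsFundSol {N : ℕ} (p : ℝ) (f : ℝ → ℝ) (k : ℝ) (u : Spc N → ℝ → ℝ) : Prop :=
  (∀ x t, 0 ≤ u x t) ∧ (∀ x t, 0 < t → 0 < u x t) ∧
  ContinuousOn (fun z : Spc N × ℝ => u z.1 z.2) ((univ : Set (Spc N)) ×ˢ Ioi (0:ℝ)) ∧
  IsWeakSolution p f univ (Ioi 0) u ∧
  ∀ ζ : Spc N → ℝ, Continuous ζ → HasCompactSupport ζ →
    Tendsto (fun t : ℝ => ∫ x : Spc N, u x t * ζ x) (𝓝[>] (0:ℝ)) (𝓝 (k * ζ 0))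

noncomputable def Fint (f : ℝ → ℝ) (s : ℝ) : ℝ := ∫ σ in (0:ℝ)..s, f σ

/-- `H_p`, the inverse of `t ↦ |t|^{p-2} t`. -/
noncomputable def Hp (p t : ℝ) : ℝ := Real.sign t * |t| ^ (1 / (p - 1))

/-- `w` solves the radial integral equation with value `a` at the origin. -/
def IsWa (N : ℕ) (p : ℝ) (f : ℝ → ℝ) (a : ℝ) (w : ℝ → ℝ) : Prop :=
  ContinuousOn w (Ici 0) ∧
  ∀ r : ℝ, 0 ≤ r →
    w r = a + ∫ s in (0:ℝ)..r,
      Hp p (s ^ (1 - (N : ℝ)) * ∫ τ in (0:ℝ)..s, τ ^ ((N : ℝ) - 1) * f (w τ))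

/-- The average `∫₀¹ θ ^ d h (s θ) dθ`, equal to `s ^ (-(d + 1)) ∫₀ˢ τ ^ d h τ dτ` for `s > 0`. -/
def radialAvg (d : ℕ) (h : ℝ → ℝ) (s : ℝ) : ℝ := ∫ θ in (0:ℝ)..1, θ ^ d * h (s * θ)

/-- The function `r ↦ ∫₀ʳ (s * radialAvg d h s) ^ α ds`. -/
def radialPotential (d : ℕ) (α : ℝ) (h : ℝ → ℝ) (r : ℝ) : ℝ :=
  ∫ s in (0:ℝ)..r, (s * radialAvg d h s) ^ α

lemma continuous_radialAvg {d : ℕ} {h : ℝ → ℝ} (hh : Continuous h) :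
    Continuous (radialAvg d h) := by
  unfold radialAvg
  apply intervalIntegral.continuous_parametric_intervalIntegral_of_continuous' (by fun_prop)

lemma mul_radialAvg_eq {d : ℕ} (h : ℝ → ℝ) {s : ℝ} (hs : 0 ≤ s) :
    s * radialAvg d h s = s ^ (-(d:ℝ)) * ∫ τ in (0:ℝ)..s, τ ^ (d:ℝ) * h τ := by
  rcases hs.eq_or_lt with rfl | hs
  · simp
  have key := intervalIntegral.integral_comp_mul_left
    (f := fun τ => (τ / s) ^ d * h τ) (a := 0) (b := 1) hs.ne'
  have h1 : radialAvg d h s = s⁻¹ * ∫ τ in (0:ℝ)..s, (τ / s) ^ d * h τ := by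
    simpa [radialAvg, hs.ne'] using key
  rw [h1, ← mul_assoc, mul_inv_cancel₀ hs.ne', one_mul, ← intervalIntegral.integral_const_mul]
  refine intervalIntegral.integral_congr fun τ _ => ?_
  simp only [Real.rpow_neg hs.le, Real.rpow_natCast, div_pow]
  field_simp

lemma radialAvg_const (d : ℕ) (c s : ℝ) : radialAvg d (fun _ => c) s = c / (d + 1) := by
  simp [radialAvg]
  ring

lemma radialAvg_mono {d : ℕ} {h k : ℝ → ℝ} (hh : Continuous h) (hk : Continuous k) {s : ℝ}
    (hs : 0 ≤ s) (hle : ∀ t ∈ Icc 0 s, h t ≤ k t) : radialAvg d h s ≤ radialAvg d k s := by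
  refine intervalIntegral.integral_mono_on zero_le_one
    (by apply Continuous.intervalIntegrable; fun_prop)
    (by apply Continuous.intervalIntegrable; fun_prop) fun θ hθ => ?_
  exact mul_le_mul_of_nonneg_left
    (hle _ ⟨mul_nonneg hs hθ.1, mul_le_of_le_one_right hs hθ.2⟩) (pow_nonneg hθ.1 _)

lemma radialAvg_nonneg {d : ℕ} {h : ℝ → ℝ} {s : ℝ} (hs : 0 ≤ s)
    (hh : ∀ t, 0 ≤ t → 0 ≤ h t) : 0 ≤ radialAvg d h s :=
  intervalIntegral.integral_nonneg zero_le_one fun _ hθ =>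
    mul_nonneg (pow_nonneg hθ.1 _) (hh _ (mul_nonneg hs hθ.1))

lemma continuous_flux_rpow {d : ℕ} {α : ℝ} (hα : 0 < α) {h : ℝ → ℝ} (hh : Continuous h) :
    Continuous fun s => (s * radialAvg d h s) ^ α :=
  (continuous_id.mul (continuous_radialAvg hh)).rpow_const fun _ => Or.inr hα.le

lemma hasDerivAt_radialPotential {d : ℕ} {α : ℝ} (hα : 0 < α) {h : ℝ → ℝ} (hh : Continuous h)
    (r : ℝ) : HasDerivAt (radialPotential d α h) ((r * radialAvg d h r) ^ α) r :=
  (continuous_flux_rpow hα hh).integral_hasStrictDerivAt 0 r |>.hasDerivAt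

lemma continuous_radialPotential {d : ℕ} {α : ℝ} (hα : 0 < α) {h : ℝ → ℝ} (hh : Continuous h) :
    Continuous (radialPotential d α h) :=
  continuous_iff_continuousAt.2 fun r => (hasDerivAt_radialPotential hα hh r).continuousAt

lemma radialPotential_nonneg {d : ℕ} {α : ℝ} {h : ℝ → ℝ} {r : ℝ} (hr : 0 ≤ r)
    (hh : ∀ t, 0 ≤ t → 0 ≤ h t) : 0 ≤ radialPotential d α h r :=
  intervalIntegral.integral_nonneg hr fun _ hs =>
    Real.rpow_nonneg (mul_nonneg hs.1 (radialAvg_nonneg hs.1 hh)) _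

lemma radialPotential_mono {d : ℕ} {α : ℝ} (hα : 0 < α) {h k : ℝ → ℝ} (hh : Continuous h)
    (hk : Continuous k) {r : ℝ} (hr : 0 ≤ r) (h0 : ∀ t, 0 ≤ t → 0 ≤ h t)
    (hle : ∀ t, 0 ≤ t → h t ≤ k t) : radialPotential d α h r ≤ radialPotential d α k r := by
  refine intervalIntegral.integral_mono_on hr
    ((continuous_flux_rpow hα hh).intervalIntegrable _ _)
    ((continuous_flux_rpow hα hk).intervalIntegrable _ _) fun s hs => ?_
  exact Real.rpow_le_rpow (mul_nonneg hs.1 (radialAvg_nonneg hs.1 h0))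
    (mul_le_mul_of_nonneg_left (radialAvg_mono hh hk hs.1 fun t ht => hle t ht.1) hs.1) hα.le

lemma hasDerivAt_flux {d : ℕ} {h : ℝ → ℝ} (hh : Continuous h) {s : ℝ} (hs : 0 < s) :
    HasDerivAt (fun s => s * radialAvg d h s) (h s - d * radialAvg d h s) s := by
  have hI : HasDerivAt (fun s => ∫ τ in (0:ℝ)..s, τ ^ (d:ℝ) * h τ) (s ^ (d:ℝ) * h s) s :=
    (Continuous.integral_hasStrictDerivAt
      (by simp only [Real.rpow_natCast]; fun_prop) 0 s).hasDerivAt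
  have hP := (Real.hasDerivAt_rpow_const (p := -(d:ℝ)) (Or.inl hs.ne')).mul hI
  have hev : (fun s => s * radialAvg d h s) =ᶠ[𝓝 s]
      (fun s => s ^ (-(d:ℝ)) * ∫ τ in (0:ℝ)..s, τ ^ (d:ℝ) * h τ) :=
    (lt_mem_nhds hs).mono fun t ht => mul_radialAvg_eq h (le_of_lt ht)
  refine (hP.congr_of_eventuallyEq hev).congr_deriv ?_
  have hA := mul_radialAvg_eq (d := d) h hs.le
  have h1 : s ^ (-(d:ℝ)) * s ^ (d:ℝ) = 1 := by
    rw [← Real.rpow_add hs]; simp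
  have h2 : s ^ (-(d:ℝ) - 1) * s = s ^ (-(d:ℝ)) := by
    rw [Real.rpow_sub_one hs.ne']; field_simp
  apply mul_left_cancel₀ hs.ne'
  linear_combination (s * h s) * h1 + (-(d:ℝ)) * (∫ τ in (0:ℝ)..s, τ ^ (d:ℝ) * h τ) * h2
    + (d:ℝ) * hA

/-- Energy estimate for subsolutions of the radial equation. -/
lemma flux_rpow_le {d : ℕ} {α a : ℝ} (hα : 0 < α) (ha : 0 < a) {g h w : ℝ → ℝ}
    (hg : Continuous g) (hg0 : ∀ x, 0 ≤ g x) (hh : Continuous h) (h0 : ∀ t, 0 ≤ t → 0 ≤ h t)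
    (hw : ∀ r, w r = a + radialPotential d α h r) (hle : ∀ t, 0 ≤ t → h t ≤ g (w t))
    {r : ℝ} (hr : 0 ≤ r) :
    (r * radialAvg d h r) ^ (α + 1) ≤ (α + 1) * Fint g (w r) := by
  have hFd : ∀ x, HasDerivAt (Fint g) (g x) x := fun x =>
    (hg.integral_hasStrictDerivAt 0 x).hasDerivAt
  have hwd : ∀ r, HasDerivAt w ((r * radialAvg d h r) ^ α) r := fun r => by
    rw [show w = fun r => a + radialPotential d α h r from funext hw]
    exact (hasDerivAt_radialPotential hα hh r).const_add a
  have hder : ∀ s, 0 < s → HasDerivAt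
      (fun s => (s * radialAvg d h s) ^ (α + 1) - (α + 1) * Fint g (w s))
      ((h s - d * radialAvg d h s) * (α + 1) * (s * radialAvg d h s) ^ (α + 1 - 1)
        - (α + 1) * (g (w s) * (s * radialAvg d h s) ^ α)) s := fun s hs =>
    ((hasDerivAt_flux hh hs).rpow_const (Or.inr (by linarith))).sub
      (((hFd (w s)).comp s (hwd s)).const_mul _)
  have hcont : Continuous
      (fun s => (s * radialAvg d h s) ^ (α + 1) - (α + 1) * Fint g (w s)) :=
    (continuous_flux_rpow (by linarith) hh).sub (continuous_const.mul
      ((continuous_iff_continuousAt.2 fun x => (hFd x).continuousAt).comp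
        (continuous_iff_continuousAt.2 fun x => (hwd x).continuousAt)))
  have hanti : AntitoneOn
      (fun s => (s * radialAvg d h s) ^ (α + 1) - (α + 1) * Fint g (w s)) (Ici 0) := by
    refine antitoneOn_of_deriv_nonpos (convex_Ici 0) hcont.continuousOn
      (fun s hs => ?_) (fun s hs => ?_)
    · rw [interior_Ici] at hs
      exact (hder s hs).differentiableAt.differentiableWithinAt
    · rw [interior_Ici] at hs
      have hs : 0 < s := hs
      rw [(hder s hs).deriv, add_sub_cancel_right]
      have hA := radialAvg_nonneg (d := d) hs.le h0
      have hX := Real.rpow_nonneg (mul_nonneg hs.le hA) α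
      have h1 := hle s hs.le
      have h2 : 0 ≤ (d:ℝ) * radialAvg d h s := by positivity
      have h3 : 0 ≤ (α + 1) * (s * radialAvg d h s) ^ α := by positivity
      nlinarith [mul_nonneg h3 (by linarith : 0 ≤ g (w s) - h s + d * radialAvg d h s)]
  have h00 := hanti self_mem_Ici (mem_Ici.2 hr) hr
  have hF0 : 0 ≤ Fint g (w 0) := by
    refine intervalIntegral.integral_nonneg ?_ fun x _ => hg0 x
    rw [hw]; simp [radialPotential, ha.le]
  simp only [zero_mul, Real.zero_rpow (by linarith : α + 1 ≠ 0)] at h00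
  nlinarith [mul_nonneg (by linarith : 0 ≤ α + 1) hF0]

lemma Fint_pos {g : ℝ → ℝ} (hg : Continuous g) (hpos : ∀ x, 0 < x → 0 < g x) {x : ℝ}
    (hx : 0 < x) : 0 < Fint g x :=
  intervalIntegral.intervalIntegral_pos_of_pos_on (hg.intervalIntegrable _ _)
    (fun t ht => hpos t ht.1) hx

/-- Under the Keller–Osserman type condition `K = ∞`, subsolutions of the radial equation are
bounded on `[0, R]` by a constant depending only on `R`. -/
lemma exists_bound_of_not_integrableOn {d : ℕ} {p a : ℝ} (hp : 1 < p) (ha : 0 < a) {g : ℝ → ℝ}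
    (hg : Continuous g) (hg0 : ∀ x, 0 ≤ g x) (hpos : ∀ x, 0 < x → 0 < g x)
    (hK : ¬ IntegrableOn (fun s : ℝ => 1 / (Fint g s) ^ (1 / p)) (Ioi 1)) (R : ℝ) :
    ∃ M, ∀ h w : ℝ → ℝ, Continuous h → (∀ t, 0 ≤ t → 0 ≤ h t) →
      (∀ r, w r = a + radialPotential d (1 / (p - 1)) h r) → (∀ t, 0 ≤ t → h t ≤ g (w t)) →
      ∀ r ∈ Icc 0 R, w r ≤ M := by
  set α := 1 / (p - 1) with hαdef
  have hp1 : 0 < p - 1 := by linarith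
  have hα : 0 < α := by positivity
  set q := fun s : ℝ => 1 / (Fint g s) ^ (1 / p) with hq
  have hFc : Continuous (Fint g) := continuous_iff_continuousAt.2 fun x =>
    (hg.integral_hasStrictDerivAt 0 x).hasDerivAt.continuousAt
  have hFp : ∀ x, 0 < x → 0 < Fint g x := fun x => Fint_pos hg hpos
  have hqc : ∀ x, 0 < x → ContinuousAt q x := fun x hx =>
    continuousAt_const.div (hFc.continuousAt.rpow_const (Or.inl (hFp x hx).ne'))
      (Real.rpow_pos_of_pos (hFp x hx) _).ne'
  have hq0 : ∀ x, 0 < x → 0 ≤ q x := fun x hx =>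
    one_div_nonneg.2 (Real.rpow_nonneg (hFp x hx).le _)
  have hqi : ∀ x y, 0 < x → 0 < y → IntervalIntegrable q volume x y := fun x y hx hy =>
    ContinuousOn.intervalIntegrable fun z hz =>
      (hqc z (lt_of_lt_of_le (lt_min hx hy) hz.1)).continuousWithinAt
  have hqm : Measurable q := by
    have := hFc.measurable
    fun_prop
  have hGd : ∀ x, 0 < x → HasDerivAt (fun x => ∫ s in (1:ℝ)..x, q s) (q x) x := fun x hx =>
    intervalIntegral.integral_hasDerivAt_right (hqi 1 x one_pos hx)
      hqm.stronglyMeasurable.stronglyMeasurableAtFilter (hqc x hx)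
  have hunb : ∀ B : ℝ, ∃ x, 1 ≤ x ∧ B < ∫ s in (1:ℝ)..x, q s := by
    by_contra! hB
    obtain ⟨B, hB⟩ := hB
    refine hK (integrableOn_Ioi_of_intervalIntegral_norm_bounded (l := atTop) (b := id) B 1
      (fun x => ?_) tendsto_id ?_)
    · rcases le_total x 1 with hx | hx
      · simp [Ioc_eq_empty_of_le hx]
      · exact (intervalIntegrable_iff_integrableOn_Ioc_of_le hx).1
          (hqi 1 x one_pos (by linarith))
    · filter_upwards [eventually_ge_atTop 1] with x hx
      refine le_trans (le_of_eq ?_) (hB x hx)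
      refine intervalIntegral.integral_congr fun s hs => ?_
      rw [id, uIcc_of_le hx] at hs
      exact Real.norm_of_nonneg (hq0 s (by linarith [hs.1]))
  set C := (α + 1) ^ (1 / p) with hC
  have hC0 : 0 ≤ C := by positivity
  obtain ⟨x, hx1, hx⟩ := hunb ((∫ s in (1:ℝ)..a, q s) + C * R)
  refine ⟨x, fun h w hh h0 hw hle r hr => ?_⟩
  have hwa : ∀ t, 0 ≤ t → a ≤ w t := fun t ht => by
    rw [hw]; linarith [radialPotential_nonneg (d := d) (α := α) ht h0]
  have hwd : ∀ r, HasDerivAt w ((r * radialAvg d h r) ^ α) r := fun r => by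
    rw [show w = fun r => a + radialPotential d α h r from funext hw]
    exact (hasDerivAt_radialPotential hα hh r).const_add a
  have hd : ∀ s, 0 ≤ s → HasDerivAt (fun s => (∫ y in (1:ℝ)..w s, q y) - C * s)
      (q (w s) * (s * radialAvg d h s) ^ α - C * 1) s := fun s hs =>
    ((hGd (w s) (ha.trans_le (hwa s hs))).comp s (hwd s)).sub ((hasDerivAt_id s).const_mul C)
  have hanti : AntitoneOn (fun s => (∫ y in (1:ℝ)..w s, q y) - C * s) (Ici 0) := by
    refine antitoneOn_of_deriv_nonpos (convex_Ici 0)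
      (fun s hs => (hd s hs).continuousAt.continuousWithinAt) (fun s hs => ?_) (fun s hs => ?_)
    · exact (hd s (interior_subset hs)).differentiableAt.differentiableWithinAt
    · have hs : 0 ≤ s := interior_subset hs
      rw [(hd s hs).deriv]
      have hX : 0 ≤ s * radialAvg d h s := mul_nonneg hs (radialAvg_nonneg hs h0)
      have hF := hFp (w s) (ha.trans_le (hwa s hs))
      have hE := flux_rpow_le hα ha hg hg0 hh h0 hw hle hs
      have h1 : (s * radialAvg d h s) ^ α ≤ C * Fint g (w s) ^ (1 / p) := by
        calc (s * radialAvg d h s) ^ α = ((s * radialAvg d h s) ^ (α + 1)) ^ (1 / p) := by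
              rw [← Real.rpow_mul hX]
              congr 1
              rw [hαdef]
              field_simp
              ring
          _ ≤ ((α + 1) * Fint g (w s)) ^ (1 / p) :=
              Real.rpow_le_rpow (Real.rpow_nonneg hX _) hE (by positivity)
          _ = C * Fint g (w s) ^ (1 / p) := Real.mul_rpow (by linarith) hF.le
      have h2 : 0 < Fint g (w s) ^ (1 / p) := Real.rpow_pos_of_pos hF _
      have h3 : q (w s) * (s * radialAvg d h s) ^ α ≤ C := by
        change 1 / Fint g (w s) ^ (1 / p) * _ ≤ C
        rwa [div_mul_eq_mul_div, one_mul, div_le_iff₀ h2]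
      linarith
  have h1 := hanti self_mem_Ici (mem_Ici.2 hr.1) hr.1
  have hw0 : w 0 = a := by rw [hw]; simp [radialPotential]
  simp only [hw0, mul_zero, sub_zero] at h1
  by_contra! hlt
  have h2 : 0 ≤ ∫ s in x..w r, q s :=
    intervalIntegral.integral_nonneg hlt.le fun s hs => hq0 s (by linarith [hs.1])
  have h3 := intervalIntegral.integral_add_adjacent_intervals
    (hqi 1 x one_pos (by linarith)) (hqi x (w r) (by linarith) (by linarith))
  nlinarith [mul_le_mul_of_nonneg_left hr.2 hC0]

/-- Picard iterates of the radial equation, starting from the constant `a`. -/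
def radialIter (d : ℕ) (α a : ℝ) (g : ℝ → ℝ) : ℕ → ℝ → ℝ
  | 0 => fun _ => a
  | n + 1 => fun r => a + radialPotential d α (fun s => g (radialIter d α a g n s)) r

lemma continuous_radialIter {d : ℕ} {α a : ℝ} {g : ℝ → ℝ} (hα : 0 < α) (hg : Continuous g)
    (n : ℕ) : Continuous (radialIter d α a g n) := by
  induction n with
  | zero => exact continuous_const
  | succ n ih => exact continuous_const.add (continuous_radialPotential hα (hg.comp ih))

lemma radialIter_le_succ {d : ℕ} {α a : ℝ} {g : ℝ → ℝ} (hα : 0 < α) (hg : Continuous g)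
    (hg0 : ∀ x, 0 ≤ g x) (hgm : Monotone g) (n : ℕ) {r : ℝ} (hr : 0 ≤ r) :
    radialIter d α a g n r ≤ radialIter d α a g (n + 1) r := by
  induction n generalizing r with
  | zero => exact le_add_of_nonneg_right (radialPotential_nonneg hr fun _ _ => hg0 _)
  | succ n ih =>
    exact add_le_add_right (radialPotential_mono hα (hg.comp (continuous_radialIter hα hg n))
      (hg.comp (continuous_radialIter hα hg (n + 1))) hr (fun _ _ => hg0 _)
      fun t ht => hgm (ih ht)) a

lemma radialIter_ge {d : ℕ} {α a : ℝ} {g : ℝ → ℝ} (hg0 : ∀ x, 0 ≤ g x) (n : ℕ) {r : ℝ}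
    (hr : 0 ≤ r) : a ≤ radialIter d α a g n r := by
  cases n with
  | zero => exact le_rfl
  | succ n => exact le_add_of_nonneg_right (radialPotential_nonneg hr fun _ _ => hg0 _)

/-- If the Picard iterates are locally bounded, they converge to a solution. -/
lemma exists_solution_of_bound {d : ℕ} {α a : ℝ} {g : ℝ → ℝ} (hα : 0 < α) (hg : Continuous g)
    (hg0 : ∀ x, 0 ≤ g x) (hgm : Monotone g)
    (hB : ∀ R : ℝ, ∃ M, ∀ n, ∀ r ∈ Icc 0 R, radialIter d α a g n r ≤ M) :
    ∃ w : ℝ → ℝ, ContinuousOn w (Ici 0) ∧ (∀ r, 0 ≤ r → a ≤ w r) ∧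
      ∀ r, 0 ≤ r → w r = a + radialPotential d α (fun s => g (w s)) r := by
  have hmono : ∀ r, 0 ≤ r → Monotone fun n => radialIter d α a g n r := fun r hr =>
    monotone_nat_of_le_succ fun n => radialIter_le_succ hα hg hg0 hgm n hr
  have hlim : ∀ r, 0 ≤ r → Tendsto (fun n => radialIter d α a g n r) atTop
      (𝓝 (⨆ n, radialIter d α a g n r)) := fun r hr => by
    obtain ⟨M, hM⟩ := hB r
    exact tendsto_atTop_ciSup (hmono r hr)
      ⟨M, by rintro _ ⟨n, rfl⟩; exact hM n r ⟨hr, le_rfl⟩⟩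
  set w := fun r => ⨆ n, radialIter d α a g n r with hw
  have hflux : ∀ R M, (∀ n, ∀ r ∈ Icc 0 R, radialIter d α a g n r ≤ M) → ∀ n, ∀ s ∈ Icc 0 R,
      ‖(s * radialAvg d (fun s => g (radialIter d α a g n s)) s) ^ α‖
        ≤ (R * (g M / (d + 1))) ^ α := by
    intro R M hM n s hs
    have h0 : 0 ≤ radialAvg d (fun s => g (radialIter d α a g n s)) s :=
      radialAvg_nonneg hs.1 fun _ _ => hg0 _
    rw [Real.norm_of_nonneg (Real.rpow_nonneg (mul_nonneg hs.1 h0) _)]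
    refine Real.rpow_le_rpow (mul_nonneg hs.1 h0)
      (mul_le_mul hs.2 ?_ h0 (hs.1.trans hs.2)) hα.le
    rw [← radialAvg_const d (g M) s]
    exact radialAvg_mono (hg.comp (continuous_radialIter hα hg n)) continuous_const hs.1
      fun t ht => hgm (hM n t ⟨ht.1, ht.2.trans hs.2⟩)
  have havg : ∀ s, 0 ≤ s → Tendsto
      (fun n => radialAvg d (fun s => g (radialIter d α a g n s)) s) atTop
      (𝓝 (radialAvg d (fun s => g (w s)) s)) := by
    intro s hs
    obtain ⟨M, hM⟩ := hB s
    refine intervalIntegral.tendsto_integral_filter_of_dominated_convergence (fun _ => g M)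
      (Eventually.of_forall fun n => ?_)
      (Eventually.of_forall fun n => ae_of_all _ fun θ hθ => ?_) (by simp)
      (ae_of_all _ fun θ hθ => ?_)
    · have := continuous_radialIter (d := d) (a := a) hα hg n
      exact Continuous.aestronglyMeasurable (by fun_prop)
    · rw [uIoc_of_le zero_le_one] at hθ
      rw [Real.norm_of_nonneg (mul_nonneg (pow_nonneg hθ.1.le _) (hg0 _))]
      refine (mul_le_of_le_one_left (hg0 _) (pow_le_one₀ hθ.1.le hθ.2)).trans (hgm (hM n _ ?_))
      exact ⟨mul_nonneg hs hθ.1.le, mul_le_of_le_one_right hs hθ.2⟩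
    · rw [uIoc_of_le zero_le_one] at hθ
      exact ((hg.tendsto _).comp (hlim _ (mul_nonneg hs hθ.1.le))).const_mul _
  refine ⟨w, ?_, fun r hr => ge_of_tendsto' (hlim r hr) fun n => radialIter_ge hg0 n hr, ?_⟩
  · have hlip : ∀ R, 0 ≤ R → ∃ C : ℝ, ∀ r ∈ Icc 0 R, ∀ r' ∈ Icc 0 R,
        |w r - w r'| ≤ C * |r - r'| := by
      intro R hR
      obtain ⟨M, hM⟩ := hB R
      refine ⟨(R * (g M / (d + 1))) ^ α, fun r hr r' hr' => ?_⟩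
      refine le_of_tendsto' (((hlim r hr.1).comp (tendsto_add_atTop_nat 1)).sub
        ((hlim r' hr'.1).comp (tendsto_add_atTop_nat 1))).abs fun n => ?_
      have hi := fun x y => (continuous_flux_rpow (d := d) hα
        (hg.comp (continuous_radialIter (d := d) (a := a) hα hg n))).intervalIntegrable
          (μ := volume) x y
      have := intervalIntegral.integral_interval_sub_left (hi 0 r) (hi 0 r')
      simp only [Function.comp_apply, radialIter, radialPotential, add_sub_add_left_eq_sub]
      simp only [Function.comp_def] at this
      rw [this, ← Real.norm_eq_abs]
      refine intervalIntegral.norm_integral_le_of_norm_le_const fun s hs => ?_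
      refine hflux R M hM n s ?_
      exact (convex_Icc (0:ℝ) R).ordConnected.uIcc_subset hr' hr (uIoc_subset_uIcc hs)
    intro r hr
    obtain ⟨C, hC⟩ := hlip (r + 1) (by linarith [mem_Ici.1 hr])
    have hr : 0 ≤ r := hr
    have hcon : ContinuousOn w (Icc 0 (r + 1)) := by
      refine (LipschitzOnWith.of_dist_le_mul (K := C.toNNReal) fun x hx y hy => ?_).continuousOn
      exact (hC x hx y hy).trans
        (mul_le_mul_of_nonneg_right (Real.le_coe_toNNReal C) (abs_nonneg _))
    refine (hcon r ⟨hr, by linarith⟩).mono_of_mem_nhdsWithin ?_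
    exact mem_nhdsWithin.2 ⟨Iio (r + 1), isOpen_Iio, by simp, fun x hx => ⟨hx.2, le_of_lt hx.1⟩⟩
  · intro r hr
    obtain ⟨M, hM⟩ := hB r
    refine tendsto_nhds_unique ((hlim r hr).comp (tendsto_add_atTop_nat 1)) ?_
    refine Tendsto.const_add a ?_
    refine intervalIntegral.tendsto_integral_filter_of_dominated_convergence
      (fun _ => (r * (g M / (d + 1))) ^ α)
      (Eventually.of_forall fun n => (continuous_flux_rpow hα
        (hg.comp (continuous_radialIter hα hg n))).aestronglyMeasurable)
      (Eventually.of_forall fun n => ae_of_all _ fun s hs => ?_) (by simp)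
      (ae_of_all _ fun s hs => ?_)
    · rw [uIoc_of_le hr] at hs
      exact hflux r M hM n s ⟨hs.1.le, hs.2⟩
    · rw [uIoc_of_le hr] at hs
      exact ((havg s hs.1.le).const_mul s).rpow_const (Or.inr hα.le)

lemma abs_radialAvg_sub_le {d : ℕ} {h k : ℝ → ℝ} (hh : Continuous h) (hk : Continuous k)
    {s c : ℝ} (hs : 0 ≤ s) (hle : ∀ t ∈ Icc 0 s, |h t - k t| ≤ c) :
    |radialAvg d h s - radialAvg d k s| ≤ c := by
  have h1 : radialAvg d h s - radialAvg d k s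
      = ∫ θ in (0:ℝ)..1, (θ ^ d * h (s * θ) - θ ^ d * k (s * θ)) :=
    (intervalIntegral.integral_sub (by apply Continuous.intervalIntegrable; fun_prop)
      (by apply Continuous.intervalIntegrable; fun_prop)).symm
  have h2 := intervalIntegral.norm_integral_le_of_norm_le_const (a := 0) (b := 1) (C := c)
    (f := fun θ => θ ^ d * h (s * θ) - θ ^ d * k (s * θ)) fun θ hθ => by
      rw [uIoc_of_le zero_le_one] at hθ
      rw [← mul_sub, Real.norm_eq_abs, abs_mul, abs_of_nonneg (pow_nonneg hθ.1.le _)]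
      exact (mul_le_of_le_one_left (abs_nonneg _) (pow_le_one₀ hθ.1.le hθ.2)).trans
        (hle _ ⟨mul_nonneg hs hθ.1.le, mul_le_of_le_one_right hs hθ.2⟩)
  rw [h1]
  simpa using h2

lemma exists_abs_rpow_sub_le (α : ℝ) {c C : ℝ} (hc : 0 < c) :
    ∃ K : ℝ, 0 ≤ K ∧ ∀ x ∈ Icc c C, ∀ y ∈ Icc c C, |x ^ α - y ^ α| ≤ K * |x - y| := by
  have hcont : ContinuousOn (fun x : ℝ => α * x ^ (α - 1)) (Icc c C) :=
    continuousOn_const.mul (continuousOn_id.rpow_const fun x hx => Or.inl (hc.trans_le hx.1).ne')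
  obtain ⟨K, hK⟩ := isCompact_Icc.exists_bound_of_continuousOn hcont
  refine ⟨max K 0, le_max_right _ _, fun x hx y hy => ?_⟩
  exact (convex_Icc c C).norm_image_sub_le_of_norm_hasDerivWithin_le
    (fun z hz => (Real.hasDerivAt_rpow_const
      (Or.inl (hc.trans_le hz.1).ne')).hasDerivWithinAt)
    (fun z hz => (hK z hz).trans (le_max_left _ _)) hy hx

lemma eqOn_of_radial_solutions {d : ℕ} {α a : ℝ} (hα : 0 < α) (ha : 0 < a) {g : ℝ → ℝ}
    (hg : Continuous g) (hgm : Monotone g) (hpos : ∀ x, 0 < x → 0 < g x)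
    (hlip : ∀ M : ℝ, 0 < M → ∃ L : ℝ≥0, LipschitzOnWith L g (Icc 0 M))
    {u v : ℝ → ℝ} (hu : Continuous u) (hv : Continuous v)
    (hua : ∀ r, 0 ≤ r → a ≤ u r) (hva : ∀ r, 0 ≤ r → a ≤ v r)
    (hue : ∀ r, 0 ≤ r → u r = a + radialPotential d α (fun s => g (u s)) r)
    (hve : ∀ r, 0 ≤ r → v r = a + radialPotential d α (fun s => g (v s)) r)
    {R : ℝ} (hR : 0 ≤ R) : u R = v R := by
  obtain ⟨M₁, hM₁⟩ := isCompact_Icc.exists_bound_of_continuousOn (hu.continuousOn (s := Icc 0 R))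
  obtain ⟨M₂, hM₂⟩ := isCompact_Icc.exists_bound_of_continuousOn (hv.continuousOn (s := Icc 0 R))
  set M := max M₁ M₂
  have huM : ∀ t ∈ Icc 0 R, u t ≤ M := fun t ht =>
    (le_abs_self _).trans ((hM₁ t ht).trans (le_max_left _ _))
  have hvM : ∀ t ∈ Icc 0 R, v t ≤ M := fun t ht =>
    (le_abs_self _).trans ((hM₂ t ht).trans (le_max_right _ _))
  have hMpos : 0 < M := (ha.trans_le (hua 0 le_rfl)).trans_le (huM 0 ⟨le_rfl, hR⟩)
  obtain ⟨L, hL⟩ := hlip M hMpos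
  obtain ⟨K, hK0, hK⟩ := exists_abs_rpow_sub_le α (c := g a / (d + 1)) (C := g M / (d + 1))
    (div_pos (hpos a ha) (by positivity))
  have hmem : ∀ z : ℝ → ℝ, Continuous z → (∀ t, 0 ≤ t → a ≤ z t) →
      (∀ t ∈ Icc 0 R, z t ≤ M) → ∀ s ∈ Icc 0 R,
      radialAvg d (fun t => g (z t)) s ∈ Icc (g a / (d + 1)) (g M / (d + 1)) := by
    intro z hz hza hzM s hs
    rw [← radialAvg_const d (g a) s, ← radialAvg_const d (g M) s]
    exact ⟨radialAvg_mono continuous_const (hg.comp hz) hs.1 fun t ht => hgm (hza t ht.1),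
      radialAvg_mono (hg.comp hz) continuous_const hs.1
        fun t ht => hgm (hzM t ⟨ht.1, ht.2.trans hs.2⟩)⟩
  have hlow : 0 ≤ g a / (d + 1) := (div_pos (hpos a ha) (by positivity)).le
  set C := R ^ α * (K * L) with hC
  have hC0 : 0 ≤ C := by positivity
  have hflux_sub : ∀ s ∈ Icc 0 R, ∀ b, (∀ t ∈ Icc 0 s, |u t - v t| ≤ b) →
      |(s * radialAvg d (fun t => g (u t)) s) ^ α - (s * radialAvg d (fun t => g (v t)) s) ^ α|
        ≤ C * b := by
    intro s hs b hb
    have hmu := hmem u hu hua huM s hs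
    have hmv := hmem v hv hva hvM s hs
    have havg : |radialAvg d (fun t => g (u t)) s - radialAvg d (fun t => g (v t)) s|
        ≤ L * b := by
      refine abs_radialAvg_sub_le (hg.comp hu) (hg.comp hv) hs.1 fun t ht => ?_
      have htR : t ∈ Icc 0 R := ⟨ht.1, ht.2.trans hs.2⟩
      refine (hL.dist_le_mul (u t) ⟨ha.le.trans (hua t ht.1), huM t htR⟩
        (v t) ⟨ha.le.trans (hva t ht.1), hvM t htR⟩).trans ?_
      exact mul_le_mul_of_nonneg_left (hb t ht) L.2
    rw [Real.mul_rpow hs.1 (hlow.trans hmu.1), Real.mul_rpow hs.1 (hlow.trans hmv.1),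
      ← mul_sub, abs_mul, abs_of_nonneg (Real.rpow_nonneg hs.1 _), hC, mul_assoc, mul_assoc]
    exact mul_le_mul (Real.rpow_le_rpow hs.1 hs.2 hα.le)
      ((hK _ hmu _ hmv).trans (mul_le_mul_of_nonneg_left havg hK0)) (abs_nonneg _)
      (Real.rpow_nonneg hR _)
  have hiter : ∀ n : ℕ, ∀ r ∈ Icc 0 R, |u r - v r| ≤ M * ((C * r) ^ n / n.factorial) := by
    intro n
    induction n with
    | zero =>
      intro r hr
      have := hua r hr.1
      have := hva r hr.1
      have := huM r hr
      have := hvM r hr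
      simp only [pow_zero, Nat.factorial_zero, Nat.cast_one, div_one, mul_one]
      exact abs_le.2 ⟨by linarith, by linarith⟩
    | succ n ih =>
      intro r hr
      have hsub := intervalIntegral.integral_sub (μ := volume)
        ((continuous_flux_rpow (d := d) hα (hg.comp hu)).intervalIntegrable 0 r)
        ((continuous_flux_rpow (d := d) hα (hg.comp hv)).intervalIntegrable 0 r)
      have hval : ∫ s in (0:ℝ)..r, C * (M * ((C * s) ^ n / n.factorial))
          = M * ((C * r) ^ (n + 1) / (n + 1).factorial) := by
        have h1 : ∀ s : ℝ, C * (M * ((C * s) ^ n / n.factorial))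
            = (C * M * C ^ n / n.factorial) * s ^ n := fun s => by rw [mul_pow]; ring
        simp only [h1, intervalIntegral.integral_const_mul, integral_pow, Nat.factorial_succ]
        push_cast
        field_simp
        ring
      rw [hue r hr.1, hve r hr.1, add_sub_add_left_eq_sub, ← hval, radialPotential,
        radialPotential]
      simp only [Function.comp_def] at hsub
      rw [← hsub, ← Real.norm_eq_abs]
      refine intervalIntegral.norm_integral_le_of_norm_le hr.1
        (ae_of_all _ fun s hs => ?_) (by apply Continuous.intervalIntegrable; fun_prop)
      have hsR : s ∈ Icc 0 R := ⟨hs.1.le, hs.2.trans hr.2⟩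
      refine hflux_sub s hsR _ fun t ht => (ih t ⟨ht.1, ht.2.trans hsR.2⟩).trans ?_
      refine mul_le_mul_of_nonneg_left ?_ hMpos.le
      have := mul_nonneg hC0 ht.1
      have := mul_le_mul_of_nonneg_left ht.2 hC0
      gcongr
  have hzero : Tendsto (fun n : ℕ => M * ((C * R) ^ n / n.factorial)) atTop (𝓝 (M * 0)) :=
    (FloorSemiring.tendsto_pow_div_factorial_atTop (C * R)).const_mul M
  rw [mul_zero] at hzero
  have := ge_of_tendsto' hzero fun n => hiter n R ⟨hR, le_rfl⟩
  exact sub_eq_zero.1 (abs_eq_zero.1 (le_antisymm this (abs_nonneg _)))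

lemma Hp_of_nonneg {p t : ℝ} (hp : 1 < p) (ht : 0 ≤ t) : Hp p t = t ^ (1 / (p - 1)) := by
  have hα : 1 / (p - 1) ≠ 0 := (one_div_pos.2 (by linarith)).ne'
  rcases ht.eq_or_lt with rfl | ht
  · rw [Hp, Real.sign_zero, zero_mul, Real.zero_rpow hα]
  · rw [Hp, Real.sign_of_pos ht, one_mul, abs_of_pos ht]

lemma Hp_flux_eq {d : ℕ} {p : ℝ} (hp : 1 < p) {k h : ℝ → ℝ} {s : ℝ} (hs : 0 ≤ s)
    (heq : ∀ τ ∈ Icc 0 s, k τ = h τ) (h0 : ∀ t, 0 ≤ t → 0 ≤ h t) :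
    Hp p (s ^ (1 - ((d + 1 : ℕ) : ℝ)) * ∫ τ in (0:ℝ)..s, τ ^ (((d + 1 : ℕ) : ℝ) - 1) * k τ)
      = (s * radialAvg d h s) ^ (1 / (p - 1)) := by
  have hI : ∫ τ in (0:ℝ)..s, τ ^ (((d + 1 : ℕ) : ℝ) - 1) * k τ
      = ∫ τ in (0:ℝ)..s, τ ^ (d:ℝ) * h τ := by
    refine intervalIntegral.integral_congr fun τ hτ => ?_
    rw [uIcc_of_le hs] at hτ
    simp [heq τ hτ]
  rw [hI, show (1 - ((d + 1 : ℕ) : ℝ)) = -(d:ℝ) by push_cast; ring, ← mul_radialAvg_eq h hs,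
    Hp_of_nonneg hp (mul_nonneg hs (radialAvg_nonneg hs h0))]

/-- Every solution of the integral equation stays above its value at the origin. -/
lemma IsWa.le_apply {N : ℕ} {p a : ℝ} {f w : ℝ → ℝ} (ha : 0 < a)
    (hf : ∀ s, 0 ≤ s → 0 ≤ f s) (hw : IsWa N p f a w) {r : ℝ} (hr : 0 ≤ r) : a ≤ w r := by
  have step : ∀ r, 0 ≤ r → (∀ y ∈ Ico 0 r, 0 ≤ w y) → a ≤ w r := by
    intro r hr hy
    rw [hw.2 r hr, intervalIntegral.integral_of_le hr, integral_Ioc_eq_integral_Ioo]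
    refine le_add_of_nonneg_right (setIntegral_nonneg measurableSet_Ioo fun s hs => ?_)
    have hX : 0 ≤ s ^ (1 - (N:ℝ)) * ∫ τ in (0:ℝ)..s, τ ^ ((N:ℝ) - 1) * f (w τ) :=
      mul_nonneg (Real.rpow_nonneg hs.1.le _) (intervalIntegral.integral_nonneg hs.1.le
        fun τ hτ => mul_nonneg (Real.rpow_nonneg hτ.1 _)
          (hf _ (hy τ ⟨hτ.1, hτ.2.trans_lt hs.2⟩)))
    refine mul_nonneg ?_ (Real.rpow_nonneg (abs_nonneg _) _)
    rcases hX.eq_or_lt with h | h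
    · rw [← h, Real.sign_zero]
    · rw [Real.sign_of_pos h]; exact zero_le_one
  refine step r hr ?_
  by_contra! hneg
  obtain ⟨y, hy, hwy⟩ := hneg
  have hcomp : IsCompact (Icc 0 y ∩ w ⁻¹' Iic 0) :=
    isCompact_Icc.of_isClosed_subset
      ((hw.1.mono Icc_subset_Ici_self).preimage_isClosed_of_isClosed isClosed_Icc isClosed_Iic)
      inter_subset_left
  obtain ⟨m, ⟨hm, hwm⟩, hmin⟩ := hcomp.exists_isLeast ⟨y, ⟨hy.1, le_rfl⟩, hwy.le⟩
  have := step m hm.1 fun z hz => by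
    by_contra! hz0
    exact absurd (hmin ⟨⟨hz.1, hz.2.le.trans hm.2⟩, hz0.le⟩) (not_le.2 hz.2)
  exact absurd hwm (not_le.2 (ha.trans_le this))

/-- when `K = ∞`, for every `a > 0` there is a unique global solution `w_a`
of the radial stationary equation with `w(0) = a`, `w'(0) = 0`. -/
theorem global_radial_stationary_solution
    {N : ℕ} (hN : 1 ≤ N) {p : ℝ} (hp : 1 < p)
    (f : ℝ → ℝ)
    (hlip : ∀ M : ℝ, 0 < M → ∃ L : ℝ≥0, LipschitzOnWith L f (Icc 0 M))
    (hfm : MonotoneOn f (Ici 0)) (hf0 : f 0 = 0) (hfpos : ∀ s : ℝ, 0 < s → 0 < f s)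
    (hK : ¬ IntegrableOn (fun s : ℝ => 1 / (Fint f s) ^ (1 / p)) (Ioi 1)) :
    ∀ a : ℝ, 0 < a → ∃ w : ℝ → ℝ, IsWa N p f a w ∧
      ∀ w' : ℝ → ℝ, IsWa N p f a w' → ∀ r : ℝ, 0 ≤ r → w' r = w r := by
  intro a ha
  obtain ⟨d, rfl⟩ : ∃ d, N = d + 1 := ⟨N - 1, by omega⟩
  have hα : 0 < 1 / (p - 1) := one_div_pos.2 (by linarith)
  have hfnn : ∀ s, 0 ≤ s → 0 ≤ f s := fun s hs => hf0 ▸ hfm self_mem_Ici hs hs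
  have hfc : ContinuousOn f (Ici 0) := by
    intro x hx
    have hx : 0 ≤ x := hx
    obtain ⟨L, hL⟩ := hlip (x + 1) (by linarith)
    refine (hL.continuousOn x ⟨hx, by linarith⟩).mono_of_mem_nhdsWithin ?_
    exact mem_nhdsWithin.2 ⟨Iio (x + 1), isOpen_Iio, by simp, fun y hy => ⟨hy.2, le_of_lt hy.1⟩⟩
  obtain ⟨g, hgdef⟩ : ∃ g : ℝ → ℝ, g = fun x => f (max x 0) := ⟨_, rfl⟩
  have hgf : ∀ x, 0 ≤ x → g x = f x := fun x hx => by rw [hgdef]; simp [hx]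
  have hg : Continuous g := by
    rw [hgdef]
    exact hfc.comp_continuous (by fun_prop) fun x => le_max_right x 0
  have hg0 : ∀ x, 0 ≤ g x := fun x => by rw [hgdef]; exact hfnn _ (le_max_right x 0)
  have hgm : Monotone g := fun x y hxy => by
    rw [hgdef]
    exact hfm (le_max_right x 0) (le_max_right y 0) (max_le_max_right 0 hxy)
  have hgpos : ∀ x, 0 < x → 0 < g x := fun x hx => by rw [hgf x hx.le]; exact hfpos x hx
  have hglip : ∀ M : ℝ, 0 < M → ∃ L : ℝ≥0, LipschitzOnWith L g (Icc 0 M) := fun M hM => by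
    obtain ⟨L, hL⟩ := hlip M hM
    refine ⟨L, fun x hx y hy => ?_⟩
    rw [hgf x hx.1, hgf y hy.1]
    exact hL hx hy
  have hgK : ¬ IntegrableOn (fun s : ℝ => 1 / (Fint g s) ^ (1 / p)) (Ioi 1) := by
    rwa [integrableOn_congr_fun (g := fun s : ℝ => 1 / (Fint f s) ^ (1 / p)) ?_ measurableSet_Ioi]
    intro s hs
    have hs : 1 < s := hs
    have : Fint g s = Fint f s := intervalIntegral.integral_congr fun x hx => by
      rw [uIcc_of_le (by linarith)] at hx
      exact hgf x hx.1
    simp only [this]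
  have hbound : ∀ R : ℝ, ∃ M, ∀ n, ∀ r ∈ Icc 0 R, radialIter d (1 / (p - 1)) a g n r ≤ M := by
    intro R
    obtain ⟨M, hM⟩ := exists_bound_of_not_integrableOn (d := d) hp ha hg hg0 hgpos hgK R
    refine ⟨M, fun n r hr => (radialIter_le_succ hα hg hg0 hgm n hr.1).trans ?_⟩
    exact hM _ _ (hg.comp (continuous_radialIter hα hg n)) (fun _ _ => hg0 _) (fun _ => rfl)
      (fun t ht => hgm (radialIter_le_succ hα hg hg0 hgm n ht)) r hr
  obtain ⟨w, hwc, hwa, hwe⟩ := exists_solution_of_bound hα hg hg0 hgm hbound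
  have hpot : ∀ z u : ℝ → ℝ, (∀ t, 0 ≤ t → 0 ≤ z t) → (∀ t, 0 ≤ t → u t = z t) → ∀ r, 0 ≤ r →
      (∫ s in (0:ℝ)..r, Hp p (s ^ (1 - ((d + 1 : ℕ) : ℝ)) *
        ∫ τ in (0:ℝ)..s, τ ^ (((d + 1 : ℕ) : ℝ) - 1) * f (z τ)))
      = radialPotential d (1 / (p - 1)) (fun s => g (u s)) r := by
    intro z u hz huz r hr
    refine intervalIntegral.integral_congr fun s hs => ?_
    rw [uIcc_of_le hr] at hs
    exact Hp_flux_eq hp hs.1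
      (fun τ hτ => by rw [huz τ hτ.1, hgf _ (hz τ hτ.1)]) fun _ _ => hg0 _
  have hwW : IsWa (d + 1) p f a w := ⟨hwc, fun r hr => by
    rw [hpot w w (fun t ht => ha.le.trans (hwa t ht)) (fun _ _ => rfl) r hr]
    exact hwe r hr⟩
  have hext : ∀ z, IsWa (d + 1) p f a z → Continuous (fun r => z (max r 0)) ∧
      (∀ r, 0 ≤ r → a ≤ z (max r 0)) ∧ ∀ r, 0 ≤ r → z (max r 0)
        = a + radialPotential d (1 / (p - 1)) (fun s => g (z (max s 0))) r := by
    intro z hz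
    refine ⟨hz.1.comp_continuous (by fun_prop) fun x => le_max_right x 0,
      fun r _ => hz.le_apply ha hfnn (le_max_right r 0), fun r hr => ?_⟩
    rw [max_eq_left hr, hz.2 r hr, hpot z (fun s => z (max s 0))
      (fun t ht => ha.le.trans (hz.le_apply ha hfnn ht)) (fun t ht => by rw [max_eq_left ht]) r hr]
  refine ⟨w, hwW, fun w' hw' r hr => ?_⟩
  obtain ⟨hc, hl, he⟩ := hext w hwW
  obtain ⟨hc', hl', he'⟩ := hext w' hw'
  simpa [hr] using eqOn_of_radial_solutions hα ha hg hgm hgpos hglip hc' hc hl' hl he' he hr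

end
end

section
/- Assume N ≥ 1, p > 1, a > 0, and f : [0,∞) → [0,∞) is continuous, nondecreasing, with f(0) = 0 and f(s) > 0 for s > 0; set F(s) = ∫_0^s f(σ) dσ. Then the following are equivalent: (i) every positive increasing solution w of the ODE (r^{N−1} |w'|^{p−2} w')' = r^{N−1} f(w) defined on an interval [a, a*] to the right of a can be continued as a solution of the same ODE on all of [a, ∞); (ii) ∫_α^∞ ds / F(s)^{1/p} = ∞ for every α > 0. -/
open MeasureTheory Set Filter Topology
open scoped RealInnerProductSpace ENNReal NNReal

noncomputable section

/-- `w` (with continuous derivative `w'`) is a solution of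
`(r^{N-1}|w'|^{p-2}w')' = r^{N-1} f(w)` on `I`. -/
def IsRadialODESol (N : ℕ) (p : ℝ) (f : ℝ → ℝ) (w w' : ℝ → ℝ) (I : Set ℝ) : Prop :=
  ContinuousOn w' I ∧ (∀ r ∈ I, HasDerivWithinAt w (w' r) I r) ∧
  ∀ r ∈ I, HasDerivWithinAt (fun s : ℝ => s ^ ((N : ℝ) - 1) * |w' s| ^ (p - 2) * w' s)
    (r ^ ((N : ℝ) - 1) * f (w r)) I r


/-- The flux `c + ∫ₐˢ ρ g(u)` of a radial profile `u`. -/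
def radialFlux (ρ g : ℝ → ℝ) (a c : ℝ) (u : ℝ → ℝ) (s : ℝ) : ℝ :=
  c + ∫ t in a..s, ρ t * g (u t)

/-- The integral operator whose fixed points solve the radial equation
with value `b` and flux `c` at `a`. -/
def radialOp (ρ g : ℝ → ℝ) (θ a b c : ℝ) (u : ℝ → ℝ) (r : ℝ) : ℝ :=
  b + ∫ s in a..r, (radialFlux ρ g a c u s / ρ s) ^ θ

section RadialOp

variable {ρ g : ℝ → ℝ} {θ a b c : ℝ}

theorem continuous_radialFlux (hρ : Continuous ρ) (hg : Continuous g) {u : ℝ → ℝ}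
    (hu : Continuous u) : Continuous (radialFlux ρ g a c u) := by
  have h : Continuous fun t => ρ t * g (u t) := hρ.mul (hg.comp hu)
  exact continuous_const.add
    (intervalIntegral.continuous_primitive (fun x y => h.intervalIntegrable x y) a)

theorem hasDerivAt_radialFlux (hρ : Continuous ρ) (hg : Continuous g) {u : ℝ → ℝ}
    (hu : Continuous u) (r : ℝ) :
    HasDerivAt (radialFlux ρ g a c u) (ρ r * g (u r)) r :=
  ((hρ.mul (hg.comp hu)).integral_hasStrictDerivAt a r).hasDerivAt.const_add c

theorem continuous_radialSpeed (hρ : Continuous ρ) (hρ0 : ∀ s, 0 < ρ s) (hg : Continuous g)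
    (hθ : 0 < θ) {u : ℝ → ℝ} (hu : Continuous u) :
    Continuous fun s => (radialFlux ρ g a c u s / ρ s) ^ θ :=
  ((continuous_radialFlux hρ hg hu).div hρ fun s => (hρ0 s).ne').rpow_const
    fun _ => Or.inr hθ.le

theorem hasDerivAt_radialOp (hρ : Continuous ρ) (hρ0 : ∀ s, 0 < ρ s) (hg : Continuous g)
    (hθ : 0 < θ) {u : ℝ → ℝ} (hu : Continuous u) (r : ℝ) :
    HasDerivAt (radialOp ρ g θ a b c u) ((radialFlux ρ g a c u r / ρ r) ^ θ) r :=
  ((continuous_radialSpeed hρ hρ0 hg hθ hu).integral_hasStrictDerivAt a r).hasDerivAt.const_add b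

theorem continuous_radialOp (hρ : Continuous ρ) (hρ0 : ∀ s, 0 < ρ s) (hg : Continuous g)
    (hθ : 0 < θ) {u : ℝ → ℝ} (hu : Continuous u) : Continuous (radialOp ρ g θ a b c u) :=
  continuous_iff_continuousAt.2 fun r =>
    (hasDerivAt_radialOp hρ hρ0 hg hθ hu r).continuousAt

theorem radialFlux_nonneg (hρ0 : ∀ s, 0 < ρ s) (hg0 : ∀ s, 0 ≤ g s) (hc : 0 ≤ c) (u : ℝ → ℝ)
    {s : ℝ} (hs : a ≤ s) : 0 ≤ radialFlux ρ g a c u s :=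
  add_nonneg hc <| intervalIntegral.integral_nonneg hs fun t _ =>
    mul_nonneg (hρ0 t).le (hg0 _)

theorem radialFlux_mono (hρ : Continuous ρ) (hρ0 : ∀ s, 0 < ρ s) (hg : Continuous g)
    (hgm : Monotone g) {u v : ℝ → ℝ} (hu : Continuous u) (hv : Continuous v) {s : ℝ} (hs : a ≤ s)
    (huv : ∀ t ∈ Icc a s, u t ≤ v t) :
    radialFlux ρ g a c u s ≤ radialFlux ρ g a c v s := by
  unfold radialFlux
  gcongr
  refine intervalIntegral.integral_mono_on hs ((hρ.mul (hg.comp hu)).intervalIntegrable _ _)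
    ((hρ.mul (hg.comp hv)).intervalIntegrable _ _) fun t ht => ?_
  exact mul_le_mul_of_nonneg_left (hgm (huv t ht)) (hρ0 t).le

theorem radialOp_mono (hρ : Continuous ρ) (hρ0 : ∀ s, 0 < ρ s) (hg : Continuous g)
    (hgm : Monotone g) (hg0 : ∀ s, 0 ≤ g s) (hθ : 0 < θ) (hc : 0 ≤ c) {u v : ℝ → ℝ}
    (hu : Continuous u) (hv : Continuous v) {r : ℝ} (hr : a ≤ r)
    (huv : ∀ t ∈ Icc a r, u t ≤ v t) :
    radialOp ρ g θ a b c u r ≤ radialOp ρ g θ a b c v r := by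
  unfold radialOp
  gcongr
  refine intervalIntegral.integral_mono_on hr
    ((continuous_radialSpeed hρ hρ0 hg hθ hu).intervalIntegrable _ _)
    ((continuous_radialSpeed hρ hρ0 hg hθ hv).intervalIntegrable _ _) fun s hs => ?_
  exact Real.rpow_le_rpow (div_nonneg (radialFlux_nonneg hρ0 hg0 hc u hs.1) (hρ0 s).le)
    (div_le_div_of_nonneg_right (radialFlux_mono hρ hρ0 hg hgm hu hv hs.1
      fun t ht => huv t ⟨ht.1, ht.2.trans hs.2⟩) (hρ0 s).le) hθ.le

theorem monotoneOn_radialOp (hρ : Continuous ρ) (hρ0 : ∀ s, 0 < ρ s) (hg : Continuous g)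
    (hg0 : ∀ s, 0 ≤ g s) (hθ : 0 < θ) (hc : 0 ≤ c) {u : ℝ → ℝ} (hu : Continuous u) :
    MonotoneOn (radialOp ρ g θ a b c u) (Ici a) := by
  refine monotoneOn_of_hasDerivWithinAt_nonneg (convex_Ici a)
    (continuous_radialOp hρ hρ0 hg hθ hu).continuousOn
    (fun x _ => (hasDerivAt_radialOp hρ hρ0 hg hθ hu x).hasDerivWithinAt) fun x hx => ?_
  have hx' : a ≤ x := interior_subset hx
  exact Real.rpow_nonneg (div_nonneg (radialFlux_nonneg hρ0 hg0 hc u hx') (hρ0 x).le) _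

theorem radialOp_congr {u v : ℝ → ℝ} {r : ℝ} (hr : a ≤ r) (huv : ∀ t ∈ Icc a r, u t = v t) :
    radialOp ρ g θ a b c u r = radialOp ρ g θ a b c v r := by
  unfold radialOp radialFlux
  congr 1
  refine intervalIntegral.integral_congr fun s hs => ?_
  rw [uIcc_of_le hr] at hs
  have : ∫ t in a..s, ρ t * g (u t) = ∫ t in a..s, ρ t * g (v t) := by
    refine intervalIntegral.integral_congr fun t ht => ?_
    rw [uIcc_of_le hs.1] at ht
    simp only [huv t ⟨ht.1, ht.2.trans hs.2⟩]
  simp only [this]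

theorem radialSpeed_le (hρ : Continuous ρ) (hρ0 : ∀ s, 0 < ρ s) (hρm : Monotone ρ)
    (hg : Continuous g) (hg0 : ∀ s, 0 ≤ g s) (hθ : 0 < θ) (hc : 0 ≤ c)
    {u : ℝ → ℝ} (hu : Continuous u) {R M : ℝ}
    (hM : ∀ t ∈ Icc a R, g (u t) ≤ M) {s : ℝ} (hs : s ∈ Icc a R) :
    (radialFlux ρ g a c u s / ρ s) ^ θ ≤ ((c + ρ R * M * (R - a)) / ρ a) ^ θ := by
  have hM0 : 0 ≤ M := (hg0 _).trans (hM s hs)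
  have h0 := radialFlux_nonneg hρ0 hg0 hc u hs.1
  have h1 : radialFlux ρ g a c u s ≤ c + ρ R * M * (R - a) := by
    unfold radialFlux
    gcongr
    calc ∫ t in a..s, ρ t * g (u t) ≤ ∫ t in a..s, ρ R * M := by
          refine intervalIntegral.integral_mono_on hs.1
            ((hρ.mul (hg.comp hu)).intervalIntegrable _ _) intervalIntegrable_const
            fun t ht => ?_
          have htR : t ≤ R := ht.2.trans hs.2
          exact mul_le_mul (hρm htR) (hM t ⟨ht.1, htR⟩) (hg0 _) (hρ0 R).le
      _ = ρ R * M * (s - a) := by simp only [intervalIntegral.integral_const, smul_eq_mul]; ring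
      _ ≤ ρ R * M * (R - a) := by
          have := hρ0 R
          have := hs.2
          gcongr
  refine Real.rpow_le_rpow (div_nonneg h0 (hρ0 s).le) ?_ hθ.le
  exact div_le_div₀ (h0.trans h1) h1 (hρ0 a) (hρm hs.1)

/-- Monotone iteration: a continuous subsolution `u₀` produces a fixed point of the radial
operator as soon as all subsolutions are locally bounded above. -/
theorem exists_radialOp_fixedPoint (hρ : Continuous ρ) (hρ0 : ∀ s, 0 < ρ s) (hρm : Monotone ρ)
    (hg : Continuous g) (hgm : Monotone g) (hg0 : ∀ s, 0 ≤ g s) (hθ : 0 < θ) (hc : 0 ≤ c)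
    {u₀ : ℝ → ℝ} (hu₀ : Continuous u₀) (hsub : ∀ r, a ≤ r → u₀ r ≤ radialOp ρ g θ a b c u₀ r)
    (hB : ∀ R, a ≤ R → ∃ B, ∀ u : ℝ → ℝ, Continuous u →
      (∀ r, a ≤ r → u r ≤ radialOp ρ g θ a b c u r) → radialOp ρ g θ a b c u R ≤ B) :
    ∃ W : ℝ → ℝ, Continuous W ∧ (∀ r, a ≤ r → W r = radialOp ρ g θ a b c W r) ∧
      ∀ r, a ≤ r → (∀ s ∈ Icc a r, radialOp ρ g θ a b c u₀ s = u₀ s) → W r = u₀ r := by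
  set T := radialOp ρ g θ a b c with hT
  choose! B hB using hB
  set U : ℕ → ℝ → ℝ := fun n => T^[n] u₀ with hU
  have hUs : ∀ n, U (n + 1) = T (U n) := fun n => Function.iterate_succ_apply' T n u₀
  have hUc : ∀ n, Continuous (U n) := fun n => by
    induction n with
    | zero => exact hu₀
    | succ n ih => rw [hUs]; exact continuous_radialOp hρ hρ0 hg hθ ih
  have hUm : ∀ n r, a ≤ r → U n r ≤ U (n + 1) r := fun n => by
    induction n with
    | zero => exact hsub
    | succ n ih =>
      intro r hr
      rw [hUs (n + 1), hUs n]
      refine radialOp_mono hρ hρ0 hg hgm hg0 hθ hc (hUc n) ?_ hr fun t ht => ?_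
      · rw [← hUs]; exact hUc _
      · rw [← hUs]; exact ih t ht.1
  have hUB : ∀ n R t, t ∈ Icc a R → U n t ≤ B R := by
    intro n R t ht
    have haR := ht.1.trans ht.2
    have hmono := monotoneOn_radialOp (b := b) hρ hρ0 hg hg0 hθ hc (hUc n) ht.1 haR ht.2
    refine (hUm n t ht.1).trans ?_
    rw [hUs]
    refine hmono.trans (hB R haR (U n) (hUc n) fun r hr => ?_)
    have := hUm n r hr
    rwa [hUs] at this
  set W : ℝ → ℝ := fun r => ⨆ n, U n (max r a) with hW
  have hlim : ∀ r, Tendsto (fun n => U n (max r a)) atTop (𝓝 (W r)) := fun r =>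
    tendsto_atTop_ciSup (monotone_nat_of_le_succ fun n => hUm n _ (le_max_right _ _))
      ⟨B (max r a), by rintro _ ⟨n, rfl⟩; exact hUB n _ _ ⟨le_max_right _ _, le_rfl⟩⟩
  have hlim' : ∀ r, a ≤ r → Tendsto (fun n => U n r) atTop (𝓝 (W r)) := fun r hr => by
    simpa [max_eq_left hr] using hlim r
  have hspeed : ∀ n R s, s ∈ Icc a R → (radialFlux ρ g a c (U n) s / ρ s) ^ θ ≤
      ((c + ρ R * g (B R) * (R - a)) / ρ a) ^ θ := fun n R s hs =>
    radialSpeed_le hρ hρ0 hρm hg hg0 hθ hc (hUc n) (fun t ht => hgm (hUB n R t ht)) hs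
  have hspeed0 : ∀ n s, a ≤ s → 0 ≤ (radialFlux ρ g a c (U n) s / ρ s) ^ θ := fun n s hs =>
    Real.rpow_nonneg (div_nonneg (radialFlux_nonneg hρ0 hg0 hc _ hs) (hρ0 s).le) _
  have hWc : Continuous W := by
    refine continuous_iff_continuousAt.2 fun r₀ => ?_
    set R := max (r₀ + 1) a
    set K := ((c + ρ R * g (B R) * (R - a)) / ρ a) ^ θ
    have hR : a ≤ R := le_max_right _ _
    have hK : 0 ≤ K := (hspeed0 0 a le_rfl).trans (hspeed 0 R a ⟨le_rfl, hR⟩)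
    have hL : LipschitzOnWith (Real.toNNReal K) W (Iic (r₀ + 1)) := by
      refine LipschitzOnWith.of_dist_le_mul fun x hx y hy => ?_
      rw [Real.coe_toNNReal _ hK]
      have hdist : dist (max x a) (max y a) ≤ dist x y := by
        simpa [Real.dist_eq] using abs_max_sub_max_le_abs x y a
      refine le_trans ?_ (mul_le_mul_of_nonneg_left hdist hK)
      refine le_of_tendsto (((tendsto_add_atTop_iff_nat 1).2 (hlim x)).dist
        ((tendsto_add_atTop_iff_nat 1).2 (hlim y))) (Eventually.of_forall fun n => ?_)
      have hi := fun p q => (continuous_radialSpeed (a := a) (c := c) hρ hρ0 hg hθ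
        (hUc n)).intervalIntegrable (μ := volume) p q
      have hxR : max x a ≤ R := max_le_max hx le_rfl
      have hyR : max y a ≤ R := max_le_max hy le_rfl
      simp only [hUs, hT, radialOp, Real.dist_eq]
      rw [add_sub_add_left_eq_sub, intervalIntegral.integral_interval_sub_left (hi _ _) (hi _ _),
        ← Real.norm_eq_abs]
      refine intervalIntegral.norm_integral_le_of_norm_le_const fun s hs => ?_
      have hs' := uIoc_subset_uIcc hs
      have hsa : s ∈ Icc a R := by
        rw [mem_uIcc] at hs'
        rcases hs' with h | h
        · exact ⟨(le_max_right _ _).trans h.1, h.2.trans hxR⟩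
        · exact ⟨(le_max_right _ _).trans h.1, h.2.trans hyR⟩
      rw [Real.norm_eq_abs, abs_of_nonneg (hspeed0 n s hsa.1)]
      exact hspeed n R s hsa
    exact hL.continuousOn.continuousAt (Iic_mem_nhds (by linarith))
  have hflux : ∀ s, a ≤ s →
      Tendsto (fun n => radialFlux ρ g a c (U n) s) atTop (𝓝 (radialFlux ρ g a c W s)) := by
    intro s hs
    refine tendsto_const_nhds.add ?_
    refine intervalIntegral.tendsto_integral_filter_of_dominated_convergence
      (fun _ => ρ s * g (B s)) (Eventually.of_forall fun n =>
        (hρ.mul (hg.comp (hUc n))).aestronglyMeasurable)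
      (Eventually.of_forall fun n => Eventually.of_forall fun t ht => ?_)
      intervalIntegrable_const (Eventually.of_forall fun t ht => ?_)
    · rw [uIoc_of_le hs] at ht
      rw [Real.norm_eq_abs, abs_of_nonneg (mul_nonneg (hρ0 t).le (hg0 _))]
      exact mul_le_mul (hρm ht.2) (hgm (hUB n s t (Ioc_subset_Icc_self ht))) (hg0 _) (hρ0 s).le
    · rw [uIoc_of_le hs] at ht
      exact ((hg.tendsto _).comp (hlim' t ht.1.le)).const_mul _
  refine ⟨W, hWc, fun r hr => ?_, fun r hr hfix => ?_⟩
  · refine tendsto_nhds_unique ((tendsto_add_atTop_iff_nat 1).2 (hlim' r hr)) ?_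
    simp only [hUs, hT, radialOp]
    refine tendsto_const_nhds.add ?_
    refine intervalIntegral.tendsto_integral_filter_of_dominated_convergence
      (fun _ => ((c + ρ r * g (B r) * (r - a)) / ρ a) ^ θ) (Eventually.of_forall fun n =>
        (continuous_radialSpeed hρ hρ0 hg hθ (hUc n)).aestronglyMeasurable)
      (Eventually.of_forall fun n => Eventually.of_forall fun t ht => ?_)
      intervalIntegrable_const (Eventually.of_forall fun t ht => ?_)
    · rw [uIoc_of_le hr] at ht
      rw [Real.norm_eq_abs, abs_of_nonneg (hspeed0 n t ht.1.le)]
      exact hspeed n r t (Ioc_subset_Icc_self ht)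
    · rw [uIoc_of_le hr] at ht
      exact ((hflux t ht.1.le).div_const _).rpow_const (Or.inr hθ.le)
  · have hconst : ∀ n, ∀ s ∈ Icc a r, U n s = u₀ s := fun n => by
      induction n with
      | zero => exact fun _ _ => rfl
      | succ n ih =>
        intro s hs
        rw [hUs, ← hfix s hs]
        exact radialOp_congr hs.1 fun t ht => ih t ⟨ht.1, ht.2.trans hs.2⟩
    refine tendsto_nhds_unique (hlim' r hr) ?_
    simp only [fun n => hconst n r ⟨hr, le_rfl⟩]
    exact tendsto_const_nhds

end RadialOp

theorem monotoneOn_Icc_of_hasDerivWithinAt_nonneg {a R : ℝ} {φ φ' : ℝ → ℝ}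
    (h : ∀ x ∈ Icc a R, HasDerivWithinAt φ (φ' x) (Icc a R) x)
    (h0 : ∀ x ∈ Icc a R, 0 ≤ φ' x) : MonotoneOn φ (Icc a R) :=
  monotoneOn_of_hasDerivWithinAt_nonneg (convex_Icc a R)
    (fun x hx => (h x hx).continuousWithinAt)
    (fun x hx => (h x (interior_subset hx)).mono interior_subset)
    fun x hx => h0 x (interior_subset hx)

section Energy

variable {g : ℝ → ℝ} {p : ℝ}

theorem hasDerivAt_Fint (hg : Continuous g) (s : ℝ) : HasDerivAt (Fint g) (g s) s :=
  (hg.integral_hasStrictDerivAt 0 s).hasDerivAt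

theorem continuous_Fint (hg : Continuous g) : Continuous (Fint g) :=
  continuous_iff_continuousAt.2 fun s => (hasDerivAt_Fint hg s).continuousAt

theorem Fint_pos_s13 (hg : Continuous g) (hgpos : ∀ s, 0 < s → 0 < g s) {s : ℝ} (hs : 0 < s) :
    0 < Fint g s :=
  intervalIntegral.intervalIntegral_pos_of_pos_on (hg.intervalIntegrable _ _)
    (fun x hx => hgpos x hx.1) hs

theorem Fint_mono (hg : Continuous g) (hg0 : ∀ s, 0 ≤ g s) : Monotone (Fint g) :=
  monotone_of_hasDerivAt_nonneg (hasDerivAt_Fint hg) hg0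

theorem continuousAt_inv_Fint_rpow (hg : Continuous g) (hgpos : ∀ s, 0 < s → 0 < g s)
    {s : ℝ} (hs : 0 < s) : ContinuousAt (fun σ => 1 / Fint g σ ^ (1 / p)) s := by
  have hF := Fint_pos_s13 hg hgpos hs
  exact continuousAt_const.div
    ((continuous_Fint hg).continuousAt.rpow_const (Or.inl hF.ne')) (Real.rpow_pos_of_pos hF _).ne'

theorem intervalIntegrable_inv_Fint_rpow (hg : Continuous g) (hgpos : ∀ s, 0 < s → 0 < g s)
    {b s : ℝ} (hb : 0 < b) (hs : 0 < s) :
    IntervalIntegrable (fun σ => 1 / Fint g σ ^ (1 / p)) volume b s := by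
  refine ContinuousOn.intervalIntegrable fun σ hσ =>
    (continuousAt_inv_Fint_rpow hg hgpos ?_).continuousWithinAt
  exact (lt_min hb hs).trans_le hσ.1

theorem hasDerivAt_integral_inv_Fint_rpow (hg : Continuous g) (hgpos : ∀ s, 0 < s → 0 < g s)
    {b s : ℝ} (hb : 0 < b) (hs : 0 < s) :
    HasDerivAt (fun x => ∫ σ in b..x, 1 / Fint g σ ^ (1 / p)) (1 / Fint g s ^ (1 / p)) s := by
  refine intervalIntegral.integral_hasDerivAt_right
    (intervalIntegrable_inv_Fint_rpow hg hgpos hb hs) ?_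
    (continuousAt_inv_Fint_rpow hg hgpos hs)
  have : Measurable fun σ => 1 / Fint g σ ^ (1 / p) :=
    measurable_const.div ((continuous_Fint hg).measurable.pow_const _)
  exact this.stronglyMeasurable.stronglyMeasurableAtFilter

variable {ρ h y v : ℝ → ℝ} {θ a R b c : ℝ}

theorem inv_sub_one_add_one_div (hp : 1 < p) (hθ : θ = (p - 1)⁻¹) : (θ + 1) * (1 / p) = θ := by
  have h1 : p - 1 ≠ 0 := by linarith
  have h2 : p ≠ 0 := by linarith
  rw [hθ]
  field_simp
  ring

/-- The energy estimate for subsolutions: `∫ F^{-1/p}` grows at most linearly. -/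
theorem integral_inv_Fint_rpow_le (hp : 1 < p) (hθ : θ = (p - 1)⁻¹) (hρ0 : ∀ s, 0 < ρ s)
    (hρm : Monotone ρ) (hg : Continuous g) (hg0 : ∀ s, 0 ≤ g s) (hgpos : ∀ s, 0 < s → 0 < g s)
    (haR : a ≤ R) (hb : 0 < b) (hc : 0 ≤ c)
    (hy : ∀ r ∈ Icc a R, HasDerivWithinAt y (ρ r * h r) (Icc a R) r)
    (hv : ∀ r ∈ Icc a R, HasDerivWithinAt v ((y r / ρ r) ^ θ) (Icc a R) r)
    (hh0 : ∀ r ∈ Icc a R, 0 ≤ h r) (hhg : ∀ r ∈ Icc a R, h r ≤ g (v r))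
    (hya : y a = c) (hva : v a = b) :
    ∫ σ in b..v R, 1 / Fint g σ ^ (1 / p) ≤
      ((θ + 1) * (ρ R ^ θ * ρ R) + c ^ (θ + 1) / Fint g b) ^ (1 / p) / ρ a ^ θ * (R - a) := by
  have hθ0 : 0 < θ := by rw [hθ]; exact inv_pos.2 (by linarith)
  have ha : a ∈ Icc a R := ⟨le_rfl, haR⟩
  have hR : R ∈ Icc a R := ⟨haR, le_rfl⟩
  have hym := monotoneOn_Icc_of_hasDerivWithinAt_nonneg hy
    fun r hr => mul_nonneg (hρ0 r).le (hh0 r hr)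
  have hy0 : ∀ r ∈ Icc a R, 0 ≤ y r := fun r hr => by
    have := hym ha hr hr.1
    linarith
  have hv0 : ∀ r ∈ Icc a R, 0 ≤ (y r / ρ r) ^ θ := fun r hr =>
    Real.rpow_nonneg (div_nonneg (hy0 r hr) (hρ0 r).le) _
  have hvm := monotoneOn_Icc_of_hasDerivWithinAt_nonneg hv hv0
  have hvb : ∀ r ∈ Icc a R, b ≤ v r := fun r hr => hva ▸ hvm ha hr hr.1
  have hFb := Fint_pos_s13 hg hgpos hb
  set K₁ := (θ + 1) * (ρ R ^ θ * ρ R) with hK₁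
  have hK₁0 : 0 < K₁ := by
    have := hρ0 R
    positivity
  have henergy : ∀ r ∈ Icc a R, y r ^ (θ + 1) ≤ c ^ (θ + 1) + K₁ * (Fint g (v r) - Fint g b) := by
    have hmono : MonotoneOn (fun r => K₁ * Fint g (v r) - y r ^ (θ + 1)) (Icc a R) := by
      refine monotoneOn_Icc_of_hasDerivWithinAt_nonneg (fun r hr =>
        (((hasDerivAt_Fint hg (v r)).comp_hasDerivWithinAt r (hv r hr)).const_mul K₁).sub
          ((hy r hr).rpow_const (Or.inr (by linarith)))) fun r hr => ?_
      have hρr := hρ0 r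
      have e : y r ^ (θ + 1 - 1) = (y r / ρ r) ^ θ * ρ r ^ θ := by
        rw [add_sub_cancel_right, Real.div_rpow (hy0 r hr) hρr.le,
          div_mul_cancel₀ _ (Real.rpow_pos_of_pos hρr _).ne']
      rw [e, sub_nonneg, hK₁]
      have h1 : ρ r ≤ ρ R := hρm hr.2
      have h2 := hhg r hr
      have h3 := hh0 r hr
      have h4 := hv0 r hr
      calc ρ r * h r * (θ + 1) * ((y r / ρ r) ^ θ * ρ r ^ θ)
          = (θ + 1) * (ρ r ^ θ * ρ r) * (h r * (y r / ρ r) ^ θ) := by ring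
        _ ≤ (θ + 1) * (ρ R ^ θ * ρ R) * (g (v r) * (y r / ρ r) ^ θ) := by
          have := hρ0 R
          gcongr
    intro r hr
    have := hmono ha hr hr.1
    simp only [hya, hva] at this
    linarith
  set K₂ := K₁ + c ^ (θ + 1) / Fint g b with hK₂
  have hK₂0 : 0 ≤ K₂ := by positivity
  have hspeed : ∀ r ∈ Icc a R,
      (y r / ρ r) ^ θ ≤ K₂ ^ (1 / p) / ρ a ^ θ * Fint g (v r) ^ (1 / p) := by
    intro r hr
    have hFv : Fint g b ≤ Fint g (v r) := Fint_mono hg hg0 (hvb r hr)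
    have h1 : y r ^ (θ + 1) ≤ K₂ * Fint g (v r) := by
      refine (henergy r hr).trans ?_
      have : c ^ (θ + 1) ≤ c ^ (θ + 1) / Fint g b * Fint g (v r) := by
        rw [div_mul_eq_mul_div, le_div_iff₀ hFb]
        gcongr
      rw [hK₂, add_mul]
      nlinarith
    have h2 : y r ^ θ ≤ K₂ ^ (1 / p) * Fint g (v r) ^ (1 / p) := by
      rw [← Real.mul_rpow hK₂0 (hFb.le.trans hFv)]
      calc y r ^ θ = (y r ^ (θ + 1)) ^ (1 / p) := by
            rw [← Real.rpow_mul (hy0 r hr), inv_sub_one_add_one_div hp hθ]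
        _ ≤ _ := Real.rpow_le_rpow (Real.rpow_nonneg (hy0 r hr) _) h1 (by positivity)
    rw [Real.div_rpow (hy0 r hr) (hρ0 r).le, div_mul_eq_mul_div]
    refine div_le_div₀ ((Real.rpow_nonneg (hy0 r hr) _).trans h2) h2
      (Real.rpow_pos_of_pos (hρ0 a) _) ?_
    exact Real.rpow_le_rpow (hρ0 a).le (hρm hr.1) hθ0.le
  set K := K₂ ^ (1 / p) / ρ a ^ θ
  have hmono : MonotoneOn (fun r => K * r - ∫ σ in b..v r, 1 / Fint g σ ^ (1 / p)) (Icc a R) := by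
    refine monotoneOn_Icc_of_hasDerivWithinAt_nonneg (fun r hr =>
      ((hasDerivWithinAt_id r _).const_mul K).sub
        ((hasDerivAt_integral_inv_Fint_rpow hg hgpos hb
          (hb.trans_le (hvb r hr))).comp_hasDerivWithinAt r (hv r hr))) fun r hr => ?_
    have hFv := Real.rpow_pos_of_pos (Fint_pos_s13 hg hgpos (hb.trans_le (hvb r hr))) (1 / p)
    rw [sub_nonneg, mul_one, div_mul_eq_mul_div, one_mul, div_le_iff₀ hFv]
    exact hspeed r hr
  have := hmono ha hR haR
  simp only [hva, intervalIntegral.integral_same] at this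
  linarith

/-- The energy estimate for solutions with large initial flux: `∫ F^{-1/p}` grows at least
linearly, with a rate independent of the initial value. -/
theorem le_integral_inv_Fint_rpow (hp : 1 < p) (hθ : θ = (p - 1)⁻¹) (hρ0 : ∀ s, 0 < ρ s)
    (hρm : Monotone ρ) (hg : Continuous g) (hg0 : ∀ s, 0 ≤ g s) (hgpos : ∀ s, 0 < s → 0 < g s)
    (haR : a ≤ R) (hb : 0 < b) (hc : 0 ≤ c)
    (hcb : c ^ (θ + 1) = (θ + 1) * (ρ a ^ θ * ρ a) * Fint g b)
    (hy : ∀ r ∈ Icc a R, HasDerivWithinAt y (ρ r * g (v r)) (Icc a R) r)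
    (hv : ∀ r ∈ Icc a R, HasDerivWithinAt v ((y r / ρ r) ^ θ) (Icc a R) r)
    (hya : y a = c) (hva : v a = b) :
    ((θ + 1) * (ρ a ^ θ * ρ a)) ^ (1 / p) / ρ R ^ θ * (R - a) ≤
      ∫ σ in b..v R, 1 / Fint g σ ^ (1 / p) := by
  have hθ0 : 0 < θ := by rw [hθ]; exact inv_pos.2 (by linarith)
  have ha : a ∈ Icc a R := ⟨le_rfl, haR⟩
  have hR : R ∈ Icc a R := ⟨haR, le_rfl⟩
  have hym := monotoneOn_Icc_of_hasDerivWithinAt_nonneg hy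
    fun r _ => mul_nonneg (hρ0 r).le (hg0 _)
  have hy0 : ∀ r ∈ Icc a R, 0 ≤ y r := fun r hr => by
    have := hym ha hr hr.1
    linarith
  have hv0 : ∀ r ∈ Icc a R, 0 ≤ (y r / ρ r) ^ θ := fun r hr =>
    Real.rpow_nonneg (div_nonneg (hy0 r hr) (hρ0 r).le) _
  have hvm := monotoneOn_Icc_of_hasDerivWithinAt_nonneg hv hv0
  have hvb : ∀ r ∈ Icc a R, b ≤ v r := fun r hr => hva ▸ hvm ha hr hr.1
  set K₁ := (θ + 1) * (ρ a ^ θ * ρ a) with hK₁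
  have hK₁0 : 0 < K₁ := by
    have := hρ0 a
    positivity
  have henergy : ∀ r ∈ Icc a R, K₁ * Fint g (v r) ≤ y r ^ (θ + 1) := by
    have hmono : MonotoneOn (fun r => y r ^ (θ + 1) - K₁ * Fint g (v r)) (Icc a R) := by
      refine monotoneOn_Icc_of_hasDerivWithinAt_nonneg (fun r hr =>
        ((hy r hr).rpow_const (Or.inr (by linarith))).sub
          (((hasDerivAt_Fint hg (v r)).comp_hasDerivWithinAt r (hv r hr)).const_mul K₁))
          fun r hr => ?_
      have hρr := hρ0 r
      have e : y r ^ (θ + 1 - 1) = (y r / ρ r) ^ θ * ρ r ^ θ := by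
        rw [add_sub_cancel_right, Real.div_rpow (hy0 r hr) hρr.le,
          div_mul_cancel₀ _ (Real.rpow_pos_of_pos hρr _).ne']
      rw [e, sub_nonneg, hK₁]
      have h1 : ρ a ≤ ρ r := hρm hr.1
      have h2 := hg0 (v r)
      have h4 := hv0 r hr
      have h5 := hρ0 a
      calc (θ + 1) * (ρ a ^ θ * ρ a) * (g (v r) * (y r / ρ r) ^ θ)
          ≤ (θ + 1) * (ρ r ^ θ * ρ r) * (g (v r) * (y r / ρ r) ^ θ) := by gcongr
        _ = ρ r * g (v r) * (θ + 1) * ((y r / ρ r) ^ θ * ρ r ^ θ) := by ring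
    intro r hr
    have := hmono ha hr hr.1
    simp only [hya, hva] at this
    linarith
  have hspeed : ∀ r ∈ Icc a R,
      K₁ ^ (1 / p) / ρ R ^ θ * Fint g (v r) ^ (1 / p) ≤ (y r / ρ r) ^ θ := by
    intro r hr
    have hF := Fint_pos_s13 hg hgpos (hb.trans_le (hvb r hr))
    have h2 : K₁ ^ (1 / p) * Fint g (v r) ^ (1 / p) ≤ y r ^ θ := by
      rw [← Real.mul_rpow hK₁0.le hF.le]
      calc _ ≤ (y r ^ (θ + 1)) ^ (1 / p) :=
            Real.rpow_le_rpow (by positivity) (henergy r hr) (by positivity)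
        _ = y r ^ θ := by
            rw [← Real.rpow_mul (hy0 r hr), inv_sub_one_add_one_div hp hθ]
    rw [Real.div_rpow (hy0 r hr) (hρ0 r).le, div_mul_eq_mul_div]
    refine div_le_div₀ (Real.rpow_nonneg (hy0 r hr) _) h2
      (Real.rpow_pos_of_pos (hρ0 r) _) ?_
    exact Real.rpow_le_rpow (hρ0 r).le (hρm hr.2) hθ0.le
  set K := K₁ ^ (1 / p) / ρ R ^ θ
  have hmono : MonotoneOn (fun r => (∫ σ in b..v r, 1 / Fint g σ ^ (1 / p)) - K * r) (Icc a R) := by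
    refine monotoneOn_Icc_of_hasDerivWithinAt_nonneg (fun r hr =>
      ((hasDerivAt_integral_inv_Fint_rpow hg hgpos hb
          (hb.trans_le (hvb r hr))).comp_hasDerivWithinAt r (hv r hr)).sub
      ((hasDerivWithinAt_id r _).const_mul K)) fun r hr => ?_
    have hFv := Real.rpow_pos_of_pos (Fint_pos_s13 hg hgpos (hb.trans_le (hvb r hr))) (1 / p)
    rw [sub_nonneg, mul_one, div_mul_eq_mul_div, one_mul, le_div_iff₀ hFv]
    exact hspeed r hr
  have := hmono ha hR haR
  simp only [hva, intervalIntegral.integral_same] at this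
  linarith

theorem exists_bound_of_not_integrableOn_inv_Fint_rpow (hg : Continuous g)
    (hgpos : ∀ s, 0 < s → 0 < g s) (hb : 0 < b)
    (hint : ¬ IntegrableOn (fun s => 1 / Fint g s ^ (1 / p)) (Ioi b)) (K : ℝ) :
    ∃ B, ∀ x, b ≤ x → ∫ σ in b..x, 1 / Fint g σ ^ (1 / p) ≤ K → x ≤ B := by
  by_contra! hcon
  have hq0 : ∀ x, 0 < x → 0 ≤ 1 / Fint g x ^ (1 / p) := fun x hx =>
    one_div_nonneg.2 (Real.rpow_nonneg (Fint_pos_s13 hg hgpos hx).le _)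
  choose x hx using fun n : ℕ => hcon n
  refine hint (integrableOn_Ioi_of_intervalIntegral_norm_bounded (l := atTop) (b := x) K b
    (fun n => ?_) (tendsto_atTop_mono (fun n => (hx n).2.2.le) tendsto_natCast_atTop_atTop)
    (Eventually.of_forall fun n => ?_))
  · exact (intervalIntegrable_iff_integrableOn_Ioc_of_le (hx n).1).1
      (intervalIntegrable_inv_Fint_rpow hg hgpos hb (hb.trans_le (hx n).1))
  · refine le_trans (le_of_eq ?_) (hx n).2.1
    refine intervalIntegral.integral_congr fun s hs => ?_
    rw [uIcc_of_le (hx n).1] at hs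
    exact Real.norm_of_nonneg (hq0 s (hb.trans_le hs.1))

theorem exists_integral_inv_Fint_rpow_lt (hg : Continuous g)
    (hgpos : ∀ s, 0 < s → 0 < g s) {α : ℝ} (hα : 0 < α)
    (hint : IntegrableOn (fun s => 1 / Fint g s ^ (1 / p)) (Ioi α)) {ε : ℝ} (hε : 0 < ε) :
    ∃ b, α < b ∧ ∀ x, b ≤ x → ∫ σ in b..x, 1 / Fint g σ ^ (1 / p) < ε := by
  set q := fun s => 1 / Fint g s ^ (1 / p) with hq
  have hlim := intervalIntegral_tendsto_integral_Ioi α hint tendsto_id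
  obtain ⟨b, hbε, hαb⟩ := ((hlim.eventually (lt_mem_nhds (sub_lt_self _ hε))).and
    (eventually_gt_atTop α)).exists
  simp only [id] at hbε
  refine ⟨b, hαb, fun x hx => ?_⟩
  have hb := hα.trans hαb
  have hadd := intervalIntegral.integral_add_adjacent_intervals
    (intervalIntegrable_inv_Fint_rpow (p := p) hg hgpos hα hb)
    (intervalIntegrable_inv_Fint_rpow (p := p) hg hgpos hb (hb.trans_le hx))
  have hle : ∫ σ in α..x, q σ ≤ ∫ σ in Ioi α, q σ := by
    rw [intervalIntegral.integral_of_le (hαb.le.trans hx)]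
    refine setIntegral_mono_set hint ?_ (Ioc_subset_Ioi_self.eventuallyLE)
    refine (ae_restrict_iff' measurableSet_Ioi).2 (Eventually.of_forall fun s hs => ?_)
    exact one_div_nonneg.2 (Real.rpow_nonneg (Fint_pos_s13 hg hgpos (hα.trans hs)).le _)
  simp only [hq] at hbε hle ⊢
  linarith

end Energy

section RadialODE

variable {N : ℕ} {p a : ℝ} {f : ℝ → ℝ}

theorem abs_rpow_sub_two_mul_self (hp : 1 < p) {x : ℝ} (hx : 0 ≤ x) :
    |x| ^ (p - 2) * x = x ^ (p - 1) := by
  rcases hx.eq_or_lt with rfl | hx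
  · rw [mul_zero, Real.zero_rpow (by linarith)]
  · rw [abs_of_pos hx]
    nth_rewrite 2 [← Real.rpow_one x]
    rw [← Real.rpow_add hx]
    ring_nf

/-- Nonnegative slopes are recovered from the flux. -/
theorem flux_div_weight_rpow (hp : 1 < p) {r x : ℝ} (hr : 0 < r) (hx : 0 ≤ x) :
    (r ^ ((N : ℝ) - 1) * |x| ^ (p - 2) * x / r ^ ((N : ℝ) - 1)) ^ (p - 1)⁻¹ = x := by
  have h := (Real.rpow_pos_of_pos hr ((N : ℝ) - 1)).ne'
  rw [mul_assoc, mul_div_cancel_left₀ _ h, abs_rpow_sub_two_mul_self hp hx,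
    ← Real.rpow_mul hx, mul_inv_cancel₀ (by linarith), Real.rpow_one]

theorem nonneg_of_flux_nonneg {r x : ℝ} (hr : 0 < r)
    (h : 0 ≤ r ^ ((N : ℝ) - 1) * |x| ^ (p - 2) * x) : 0 ≤ x := by
  by_contra! hx
  have h1 := Real.rpow_pos_of_pos hr ((N : ℝ) - 1)
  have h2 := Real.rpow_pos_of_pos (abs_pos.2 hx.ne) (p - 2)
  exact absurd h (not_le.2 (mul_neg_of_pos_of_neg (mul_pos h1 h2) hx))

theorem IsRadialODESol.mono {w w' : ℝ → ℝ} {I J : Set ℝ} (h : IsRadialODESol N p f w w' I)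
    (hJ : J ⊆ I) : IsRadialODESol N p f w w' J :=
  ⟨h.1.mono hJ, fun r hr => (h.2.1 r (hJ hr)).mono hJ, fun r hr => (h.2.2 r (hJ hr)).mono hJ⟩

/-- The weight `r ^ (N - 1)`, frozen to the left of `a`. -/
def radialWeight (N : ℕ) (a r : ℝ) : ℝ := max r a ^ ((N : ℝ) - 1)

theorem radialWeight_of_le {r : ℝ} (hr : a ≤ r) : radialWeight N a r = r ^ ((N : ℝ) - 1) := by
  rw [radialWeight, max_eq_left hr]

theorem continuous_radialWeight (ha : 0 < a) : Continuous (radialWeight N a) :=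
  (continuous_id.max continuous_const).rpow_const
    fun _ => Or.inl (ha.trans_le (le_max_right _ _)).ne'

theorem radialWeight_pos (ha : 0 < a) (r : ℝ) : 0 < radialWeight N a r :=
  Real.rpow_pos_of_pos (ha.trans_le (le_max_right _ _)) _

theorem monotone_radialWeight (hN : 1 ≤ N) (ha : 0 < a) : Monotone (radialWeight N a) :=
  fun _ _ hrs => Real.rpow_le_rpow (ha.le.trans (le_max_right _ _)) (max_le_max_right a hrs)
    (sub_nonneg.2 (by exact_mod_cast hN))

/-- Fixed points of the radial operator solve the radial equation. -/
theorem isRadialODESol_of_fixedPoint (hp : 1 < p) (ha : 0 < a) {g W : ℝ → ℝ} {b c : ℝ}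
    (hg : Continuous g) (hg0 : ∀ s, 0 ≤ g s) (hc : 0 ≤ c) (hW : Continuous W) {I : Set ℝ}
    (hI : I ⊆ Ici a)
    (hfix : ∀ r ∈ I, W r = radialOp (radialWeight N a) g (p - 1)⁻¹ a b c W r)
    (hgf : ∀ r ∈ I, g (W r) = f (W r)) :
    IsRadialODESol N p f W
      (fun s => (radialFlux (radialWeight N a) g a c W s / radialWeight N a s) ^ (p - 1)⁻¹) I := by
  have hρ := continuous_radialWeight (N := N) ha
  have hρ0 := radialWeight_pos (N := N) ha
  have hθ : 0 < (p - 1)⁻¹ := inv_pos.2 (by linarith)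
  refine ⟨(continuous_radialSpeed hρ hρ0 hg hθ hW).continuousOn, fun r hr => ?_, fun r hr => ?_⟩
  · exact (hasDerivAt_radialOp (b := b) hρ hρ0 hg hθ hW r).hasDerivWithinAt.congr hfix (hfix r hr)
  · have hflux : ∀ s ∈ I, s ^ ((N : ℝ) - 1) *
        |(radialFlux (radialWeight N a) g a c W s / radialWeight N a s) ^ (p - 1)⁻¹| ^ (p - 2) *
        (radialFlux (radialWeight N a) g a c W s / radialWeight N a s) ^ (p - 1)⁻¹ =
        radialFlux (radialWeight N a) g a c W s := by
      intro s hs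
      have h0 := div_nonneg (radialFlux_nonneg hρ0 hg0 hc W (hI hs)) (hρ0 s).le
      rw [mul_assoc, abs_rpow_sub_two_mul_self hp (Real.rpow_nonneg h0 _), ← Real.rpow_mul h0,
        inv_mul_cancel₀ (by linarith), Real.rpow_one, ← radialWeight_of_le (hI hs),
        mul_div_cancel₀ _ (hρ0 s).ne']
    refine HasDerivWithinAt.congr ?_ hflux (hflux r hr)
    rw [← radialWeight_of_le (N := N) (hI hr), ← hgf r hr]
    exact (hasDerivAt_radialFlux hρ hg hW r).hasDerivWithinAt

theorem IsRadialODESol.deriv_nonneg (ha : 0 < a) (hf : ∀ s, 0 < s → 0 < f s) {R : ℝ}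
    {V V' : ℝ → ℝ} (hV : IsRadialODESol N p f V V' (Icc a R)) (hVa' : 0 ≤ V' a)
    (hpos : ∀ r ∈ Ioo a R, 0 < V r) : ∀ r ∈ Icc a R, 0 ≤ V' r := by
  intro r hr
  have hmono := monotoneOn_of_hasDerivWithinAt_nonneg (convex_Icc a R)
    (fun x hx => (hV.2.2 x hx).continuousWithinAt)
    (fun x hx => (hV.2.2 x (interior_subset hx)).mono interior_subset) fun x hx => by
      rw [interior_Icc] at hx
      exact mul_nonneg (Real.rpow_nonneg (ha.trans hx.1).le _) (hf _ (hpos x hx)).le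
  refine nonneg_of_flux_nonneg (N := N) (p := p) (ha.trans_le hr.1) (le_trans ?_
    (hmono ⟨le_rfl, hr.1.trans hr.2⟩ hr hr.1))
  exact mul_nonneg (mul_nonneg (Real.rpow_nonneg ha.le _) (Real.rpow_nonneg (abs_nonneg _) _)) hVa'

theorem IsRadialODESol.pos (ha : 0 < a) (hf : ∀ s, 0 < s → 0 < f s) {R : ℝ}
    {V V' : ℝ → ℝ} (hV : IsRadialODESol N p f V V' (Icc a R)) (hVa : 0 < V a) (hVa' : 0 ≤ V' a) :
    ∀ r ∈ Icc a R, 0 < V r := by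
  by_contra! hcon
  obtain ⟨r₁, hr₁, hneg⟩ := hcon
  have hcont : ContinuousOn V (Icc a R) := fun r hr => (hV.2.1 r hr).continuousWithinAt
  have hcomp : IsCompact (Icc a R ∩ V ⁻¹' Iic 0) :=
    isCompact_Icc.of_isClosed_subset (hcont.preimage_isClosed_of_isClosed isClosed_Icc isClosed_Iic)
      inter_subset_left
  obtain ⟨r₀, ⟨hr₀, hVr₀⟩, hleast⟩ := hcomp.exists_isLeast ⟨r₁, hr₁, hneg⟩
  have hsub : Icc a r₀ ⊆ Icc a R := Icc_subset_Icc_right hr₀.2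
  have hV₀ := hV.mono hsub
  have hd := hV₀.deriv_nonneg ha hf hVa' fun r hr => by
    by_contra! hle
    exact absurd (hleast ⟨hsub (Ioo_subset_Icc_self hr), hle⟩) (not_le.2 hr.2)
  have := monotoneOn_Icc_of_hasDerivWithinAt_nonneg hV₀.2.1 hd ⟨le_rfl, hr₀.1⟩ ⟨hr₀.1, le_rfl⟩ hr₀.1
  exact absurd (hVa.trans_le this) (not_lt.2 hVr₀)

theorem Fint_congr {g : ℝ → ℝ} (hgf : ∀ s, 0 ≤ s → g s = f s) {s : ℝ} (hs : 0 ≤ s) :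
    Fint g s = Fint f s :=
  intervalIntegral.integral_congr fun x hx => hgf x (by rw [uIcc_of_le hs] at hx; exact hx.1)

theorem integrableOn_inv_Fint_congr {g : ℝ → ℝ} (hgf : ∀ s, 0 ≤ s → g s = f s) {α : ℝ}
    (hα : 0 < α) :
    IntegrableOn (fun s => 1 / Fint f s ^ (1 / p)) (Ioi α) ↔
      IntegrableOn (fun s => 1 / Fint g s ^ (1 / p)) (Ioi α) :=
  integrableOn_congr_fun (fun s hs => by
    simp only [Fint_congr hgf (hα.trans hs).le]) measurableSet_Ioi

/-- A nondecreasing solution on `[a, a⋆]`, frozen after `a⋆`, is a fixed point on `[a, a⋆]`. -/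
theorem radialOp_frozen_eq (hp : 1 < p) (ha : 0 < a) {g u w w' : ℝ → ℝ} {R : ℝ}
    (hg : Continuous g) (hu : Continuous u) (huw : ∀ r ∈ Icc a R, u r = w r)
    (hgf : ∀ r ∈ Icc a R, g (w r) = f (w r))
    (hw : IsRadialODESol N p f w w' (Icc a R)) (hw' : ∀ r ∈ Icc a R, 0 ≤ w' r) :
    ∀ r ∈ Icc a R, radialOp (radialWeight N a) g (p - 1)⁻¹ a (w a)
      (a ^ ((N : ℝ) - 1) * |w' a| ^ (p - 2) * w' a) u r = w r := by
  have hρ := continuous_radialWeight (N := N) ha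
  have hρ0 := radialWeight_pos (N := N) ha
  have hθ : 0 < (p - 1)⁻¹ := inv_pos.2 (by linarith)
  set c := a ^ ((N : ℝ) - 1) * |w' a| ^ (p - 2) * w' a with hc
  have hflux : ∀ s ∈ Icc a R, radialFlux (radialWeight N a) g a c u s =
      s ^ ((N : ℝ) - 1) * |w' s| ^ (p - 2) * w' s := by
    intro s hs
    have hsub : Icc a s ⊆ Icc a R := Icc_subset_Icc_right hs.2
    have := intervalIntegral.integral_eq_sub_of_hasDerivAt_of_le
      (f' := fun t => radialWeight N a t * g (u t)) hs.1
      (fun x hx => (hw.2.2 x (hsub hx)).continuousWithinAt.mono hsub)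
      (fun x hx => by
        have hx' := hsub (Ioo_subset_Icc_self hx)
        rw [radialWeight_of_le hx.1.le, huw x hx', hgf x hx']
        exact (hw.2.2 x hx').hasDerivAt (Icc_mem_nhds hx.1 (hx.2.trans_le hs.2)))
      ((hρ.mul (hg.comp hu)).intervalIntegrable _ _)
    rw [radialFlux, this, hc]
    ring
  have hspeed : ∀ s ∈ Icc a R,
      (radialFlux (radialWeight N a) g a c u s / radialWeight N a s) ^ (p - 1)⁻¹ = w' s := by
    intro s hs
    rw [hflux s hs, radialWeight_of_le hs.1,
      flux_div_weight_rpow hp (ha.trans_le hs.1) (hw' s hs)]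
  intro r hr
  have hsub : Icc a r ⊆ Icc a R := Icc_subset_Icc_right hr.2
  have := intervalIntegral.integral_eq_sub_of_hasDerivAt_of_le
    (f' := fun s => (radialFlux (radialWeight N a) g a c u s / radialWeight N a s) ^ (p - 1)⁻¹) hr.1
    (fun x hx => (hw.2.1 x (hsub hx)).continuousWithinAt.mono hsub)
    (fun x hx => by
      have hx' := hsub (Ioo_subset_Icc_self hx)
      rw [hspeed x hx']
      exact (hw.2.1 x hx').hasDerivAt (Icc_mem_nhds hx.1 (hx.2.trans_le hr.2)))
    ((continuous_radialSpeed hρ hρ0 hg hθ hu).intervalIntegrable _ _)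
  rw [radialOp, this]
  ring

variable {g : ℝ → ℝ}

/-- The Keller–Osserman type condition implies continuation to `[a, ∞)`. -/
theorem exists_continuation (hN : 1 ≤ N) (hp : 1 < p) (ha : 0 < a) (hg : Continuous g)
    (hgm : Monotone g) (hg0 : ∀ s, 0 ≤ g s) (hgpos : ∀ s, 0 < s → 0 < g s)
    (hgf : ∀ s, 0 ≤ s → g s = f s)
    (hint : ∀ α, 0 < α → ¬ IntegrableOn (fun s => 1 / Fint g s ^ (1 / p)) (Ioi α))
    {R : ℝ} {w w' : ℝ → ℝ} (haR : a < R) (hw : IsRadialODESol N p f w w' (Icc a R))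
    (hpos : ∀ r ∈ Icc a R, 0 < w r) (hmono : MonotoneOn w (Icc a R)) :
    ∃ W W' : ℝ → ℝ, IsRadialODESol N p f W W' (Ici a) ∧ ∀ r ∈ Icc a R, W r = w r := by
  have hρ := continuous_radialWeight (N := N) ha
  have hρ0 := radialWeight_pos (N := N) ha
  have hρm := monotone_radialWeight hN ha
  have hθ : 0 < (p - 1)⁻¹ := inv_pos.2 (by linarith)
  have haI : a ∈ Icc a R := ⟨le_rfl, haR.le⟩
  have hRI : R ∈ Icc a R := ⟨haR.le, le_rfl⟩
  have hw' : ∀ r ∈ Icc a R, 0 ≤ w' r := fun r hr => by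
    rw [← (hw.2.1 r hr).derivWithin (uniqueDiffOn_Icc haR r hr)]
    exact hmono.derivWithin_nonneg
  have hb := hpos a haI
  set c := a ^ ((N : ℝ) - 1) * |w' a| ^ (p - 2) * w' a
  have hc : 0 ≤ c := mul_nonneg (mul_nonneg (Real.rpow_nonneg ha.le _)
    (Real.rpow_nonneg (abs_nonneg _) _)) (hw' a haI)
  set u : ℝ → ℝ := IccExtend haR.le (domRestrict (Icc a R) w)
  have hu : Continuous u := (continuousOn_iff_continuous_domRestrict.1
    fun r hr => (hw.2.1 r hr).continuousWithinAt).Icc_extend'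
  have huw : ∀ r ∈ Icc a R, u r = w r := fun r hr => IccExtend_of_mem _ _ hr
  have huR : ∀ r, R ≤ r → u r = w R := fun r hr => IccExtend_of_right_le _ _ hr
  have hfix := radialOp_frozen_eq hp ha hg hu huw (fun r hr => hgf _ (hpos r hr).le) hw hw'
  have hsub : ∀ r, a ≤ r → u r ≤ radialOp (radialWeight N a) g (p - 1)⁻¹ a (w a) c u r := by
    intro r hr
    rcases le_total r R with h | h
    · rw [hfix r ⟨hr, h⟩, huw r ⟨hr, h⟩]
    · rw [huR r h, ← hfix R hRI]
      exact monotoneOn_radialOp hρ hρ0 hg hg0 hθ hc hu haR.le hr h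
  obtain ⟨W, hWc, hW, hWu⟩ := exists_radialOp_fixedPoint hρ hρ0 hρm hg hgm hg0 hθ hc hu hsub
    fun S hS => by
      obtain ⟨B, hB⟩ := exists_bound_of_not_integrableOn_inv_Fint_rpow hg hgpos hb (hint _ hb)
        ((((p - 1)⁻¹ + 1) * (radialWeight N a S ^ (p - 1)⁻¹ * radialWeight N a S) +
          c ^ ((p - 1)⁻¹ + 1) / Fint g (w a)) ^ (1 / p) / radialWeight N a a ^ (p - 1)⁻¹ * (S - a))
      refine ⟨B, fun v hv hvsub => ?_⟩
      have hva : radialOp (radialWeight N a) g (p - 1)⁻¹ a (w a) c v a = w a := by simp [radialOp]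
      refine hB _ ?_ ?_
      · conv_lhs => rw [← hva]
        exact monotoneOn_radialOp hρ hρ0 hg hg0 hθ hc hv (mem_Ici.2 le_rfl) hS hS
      · exact integral_inv_Fint_rpow_le (h := fun r => g (v r)) hp rfl hρ0 hρm hg hg0 hgpos hS hb hc
          (fun r _ => (hasDerivAt_radialFlux hρ hg hv r).hasDerivWithinAt)
          (fun r _ => (hasDerivAt_radialOp hρ hρ0 hg hθ hv r).hasDerivWithinAt)
          (fun r _ => hg0 _) (fun r hr => hgm (hvsub r hr.1)) (by simp [radialFlux]) hva
  have hWw : ∀ r ∈ Icc a R, W r = w r := fun r hr => by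
    rw [hWu r hr.1 fun s hs => ?_, huw r hr]
    have hsR : s ∈ Icc a R := ⟨hs.1, hs.2.trans hr.2⟩
    rw [hfix s hsR, huw s hsR]
  refine ⟨W, _, isRadialODESol_of_fixedPoint hp ha hg hg0 hc hWc Subset.rfl hW fun r hr => ?_, hWw⟩
  refine hgf _ ?_
  have hWm : W a ≤ W r := by
    rw [hW a le_rfl, hW r hr]
    exact monotoneOn_radialOp hρ hρ0 hg hg0 hθ hc hWc (mem_Ici.2 le_rfl) hr hr
  rw [hWw a haI] at hWm
  exact hb.le.trans hWm

/-- Local solvability with prescribed positive value and nonnegative flux at `a`. -/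
theorem exists_local_isRadialODESol (hN : 1 ≤ N) (hp : 1 < p) (ha : 0 < a) (hg : Continuous g)
    (hgm : Monotone g) (hg0 : ∀ s, 0 ≤ g s) (hgf : ∀ s, 0 ≤ s → g s = f s)
    {b c : ℝ} (hb : 0 < b) (hc : 0 ≤ c) :
    ∃ R > a, ∃ w w' : ℝ → ℝ, IsRadialODESol N p f w w' (Icc a R) ∧
      (∀ r ∈ Icc a R, 0 < w r) ∧ MonotoneOn w (Icc a R) ∧ w a = b ∧
      w' a = (c / a ^ ((N : ℝ) - 1)) ^ (p - 1)⁻¹ := by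
  have hρ := continuous_radialWeight (N := N) ha
  have hρ0 := radialWeight_pos (N := N) ha
  have hρm := monotone_radialWeight hN ha
  have hθ : 0 < (p - 1)⁻¹ := inv_pos.2 (by linarith)
  set k : ℝ → ℝ := fun s => min (g s) (g (b + 1)) with hk
  have hkc : Continuous k := hg.min continuous_const
  have hkm : Monotone k := fun s t hst => min_le_min_right _ (hgm hst)
  have hk0 : ∀ s, 0 ≤ k s := fun s => le_min (hg0 s) (hg0 _)
  have hopa : ∀ v, radialOp (radialWeight N a) k (p - 1)⁻¹ a b c v a = b := fun v => by
    simp [radialOp]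
  have hopm : ∀ v, Continuous v → ∀ r, a ≤ r →
      b ≤ radialOp (radialWeight N a) k (p - 1)⁻¹ a b c v r := fun v hv r hr => by
    conv_lhs => rw [← hopa v]
    exact monotoneOn_radialOp hρ hρ0 hkc hk0 hθ hc hv (mem_Ici.2 le_rfl) hr hr
  obtain ⟨W, hWc, hW, -⟩ := exists_radialOp_fixedPoint hρ hρ0 hρm hkc hkm hk0 hθ hc
    (continuous_const (y := b)) (hopm _ continuous_const) fun S hS => by
      refine ⟨b + ((c + radialWeight N a S * g (b + 1) * (S - a)) / radialWeight N a a) ^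
        (p - 1)⁻¹ * (S - a), fun v hv _ => ?_⟩
      unfold radialOp
      gcongr
      refine (intervalIntegral.integral_mono_on hS
        ((continuous_radialSpeed hρ hρ0 hkc hθ hv).intervalIntegrable _ _) intervalIntegrable_const
        fun s hs => radialSpeed_le hρ hρ0 hρm hkc hk0 hθ hc hv
          (fun t _ => min_le_right _ _) hs).trans (le_of_eq ?_)
      rw [intervalIntegral.integral_const, smul_eq_mul, mul_comm]
  have hWa : W a = b := by rw [hW a le_rfl, hopa]
  have hWb : ∀ r, a ≤ r → b ≤ W r := fun r hr => by rw [hW r hr]; exact hopm W hWc r hr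
  obtain ⟨δ, hδ, hball⟩ := Metric.eventually_nhds_iff.1
    (hWc.continuousAt.eventually (gt_mem_nhds (show W a < b + 1 by linarith)))
  have hsmall : ∀ r ∈ Icc a (a + δ / 2), W r < b + 1 := fun r hr => hball (by
    rw [Real.dist_eq, abs_of_nonneg (sub_nonneg.2 hr.1)]
    linarith [hr.2])
  refine ⟨a + δ / 2, by linarith, W, _, isRadialODESol_of_fixedPoint hp ha hkc hk0 hc hWc
    Icc_subset_Ici_self (fun r hr => hW r hr.1) fun r hr => ?_,
    fun r hr => hb.trans_le (hWb r hr.1), fun r hr s hs hrs => ?_, hWa, ?_⟩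
  · rw [← hgf _ (hb.le.trans (hWb r hr.1))]
    exact min_eq_left (hgm (hsmall r hr).le)
  · rw [hW r hr.1, hW s hs.1]
    exact monotoneOn_radialOp hρ hρ0 hkc hk0 hθ hc hWc hr.1 hs.1 hrs
  · simp [radialFlux, radialWeight]

/-- If `F^{-1/p}` is integrable at infinity, some local solution blows up. -/
theorem not_integrableOn_of_continuation (hN : 1 ≤ N) (hp : 1 < p) (ha : 0 < a)
    (hg : Continuous g) (hgm : Monotone g) (hg0 : ∀ s, 0 ≤ g s) (hgpos : ∀ s, 0 < s → 0 < g s)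
    (hgf : ∀ s, 0 ≤ s → g s = f s)
    (hcont : ∀ (R : ℝ) (w w' : ℝ → ℝ), a < R → IsRadialODESol N p f w w' (Icc a R) →
        (∀ r ∈ Icc a R, 0 < w r) → MonotoneOn w (Icc a R) →
        ∃ W W' : ℝ → ℝ, IsRadialODESol N p f W W' (Ici a) ∧ ∀ r ∈ Icc a R, W r = w r)
    {α : ℝ} (hα : 0 < α) : ¬ IntegrableOn (fun s => 1 / Fint g s ^ (1 / p)) (Ioi α) := by
  intro hint
  have hρ0 := radialWeight_pos (N := N) ha
  have hρm := monotone_radialWeight hN ha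
  have hθ : 0 < (p - 1)⁻¹ := inv_pos.2 (by linarith)
  set θ := (p - 1)⁻¹ with hθp
  set K := (θ + 1) * (radialWeight N a a ^ θ * radialWeight N a a)
  have hK : 0 < K := by
    have := hρ0 a
    positivity
  have hε : 0 < K ^ (1 / p) / radialWeight N a (2 * a) ^ θ * (2 * a - a) :=
    mul_pos (div_pos (Real.rpow_pos_of_pos hK _) (Real.rpow_pos_of_pos (hρ0 _) _)) (by linarith)
  obtain ⟨b, hαb, hsmall⟩ := exists_integral_inv_Fint_rpow_lt hg hgpos hα hint hε
  have hb := hα.trans hαb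
  have hKF : 0 ≤ K * Fint g b := mul_nonneg hK.le (Fint_pos_s13 hg hgpos hb).le
  set c := (K * Fint g b) ^ (θ + 1)⁻¹
  have hc : 0 ≤ c := Real.rpow_nonneg hKF _
  have hcb : c ^ (θ + 1) = K * Fint g b := by
    rw [← Real.rpow_mul hKF, inv_mul_cancel₀ (by linarith), Real.rpow_one]
  obtain ⟨R, haR, w, w', hw, hwpos, hwm, hwa, hwa'⟩ :=
    exists_local_isRadialODESol hN hp ha hg hgm hg0 hgf hb hc
  obtain ⟨V, V', hV, hVw⟩ := hcont R w w' haR hw hwpos hwm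
  have haI : a ∈ Icc a R := ⟨le_rfl, haR.le⟩
  have hVa : V a = b := by rw [hVw a haI, hwa]
  have hda : 0 ≤ c / a ^ ((N : ℝ) - 1) := div_nonneg hc (Real.rpow_nonneg ha.le _)
  have hVa' : V' a = (c / a ^ ((N : ℝ) - 1)) ^ θ := by
    rw [← hwa']
    refine (uniqueDiffOn_Icc haR a haI).eq_deriv _ ?_ (hw.2.1 a haI)
    exact ((hV.2.1 a (mem_Ici.2 le_rfl)).mono Icc_subset_Ici_self).congr
      (fun r hr => (hVw r hr).symm) (hVw a haI).symm
  have hVa0 : 0 ≤ V' a := hVa' ▸ Real.rpow_nonneg hda _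
  have hV₂ : IsRadialODESol N p f V V' (Icc a (2 * a)) := hV.mono Icc_subset_Ici_self
  have hfpos : ∀ s, 0 < s → 0 < f s := fun s hs => hgf s hs.le ▸ hgpos s hs
  have hVpos := hV₂.pos ha hfpos (hVa ▸ hb) hVa0
  have hVd := hV₂.deriv_nonneg ha hfpos hVa0 fun r hr => hVpos r (Ioo_subset_Icc_self hr)
  have ha2 : a ≤ 2 * a := by linarith
  have hbV : b ≤ V (2 * a) := hVa ▸ monotoneOn_Icc_of_hasDerivWithinAt_nonneg hV₂.2.1 hVd
    ⟨le_rfl, ha2⟩ ⟨ha2, le_rfl⟩ ha2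
  refine absurd (hsmall _ hbV) (not_lt.2 (le_integral_inv_Fint_rpow
    (y := fun s => s ^ ((N : ℝ) - 1) * |V' s| ^ (p - 2) * V' s) hp hθp hρ0 hρm hg hg0 hgpos
    ha2 hb hc hcb (fun r hr => ?_) (fun r hr => ?_) ?_ hVa))
  · rw [radialWeight_of_le hr.1, hgf _ (hVpos r hr).le]
    exact hV₂.2.2 r hr
  · rw [radialWeight_of_le hr.1, flux_div_weight_rpow hp (ha.trans_le hr.1) (hVd r hr)]
    exact hV₂.2.1 r hr
  · rw [mul_assoc, abs_rpow_sub_two_mul_self hp hVa0, hVa', ← Real.rpow_mul hda, hθp,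
      inv_mul_cancel₀ (by linarith), Real.rpow_one,
      mul_div_cancel₀ _ (Real.rpow_pos_of_pos ha _).ne']

end RadialODE

/-- every positive increasing local solution of the radial stationary
equation extends to `[a,∞)` iff `∫^∞ ds/F(s)^{1/p} = ∞`. -/
theorem continuation_iff_K_infinite
    {N : ℕ} (hN : 1 ≤ N) {p : ℝ} (hp : 1 < p) {a : ℝ} (ha : 0 < a)
    (f : ℝ → ℝ) (hfc : ContinuousOn f (Ici 0)) (hfm : MonotoneOn f (Ici 0))
    (hf0 : f 0 = 0) (hfpos : ∀ s : ℝ, 0 < s → 0 < f s) :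
    (∀ (astar : ℝ) (w w' : ℝ → ℝ), a < astar →
        IsRadialODESol N p f w w' (Icc a astar) →
        (∀ r ∈ Icc a astar, 0 < w r) → MonotoneOn w (Icc a astar) →
        ∃ W W' : ℝ → ℝ, IsRadialODESol N p f W W' (Ici a) ∧
          ∀ r ∈ Icc a astar, W r = w r)
    ↔ (∀ α : ℝ, 0 < α →
        ¬ IntegrableOn (fun s : ℝ => 1 / (Fint f s) ^ (1 / p)) (Ioi α)) := by
  have hg : Continuous fun s => f (max s 0) :=
    hfc.comp_continuous (continuous_id.max continuous_const) fun s => le_max_right s 0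
  have hgm : Monotone fun s => f (max s 0) := fun s t hst =>
    hfm (le_max_right s 0) (le_max_right t 0) (max_le_max_right 0 hst)
  have hg0 : ∀ s, 0 ≤ f (max s 0) := fun s =>
    hf0.ge.trans (hfm (mem_Ici.2 le_rfl) (le_max_right s 0) (le_max_right s 0))
  have hgf : ∀ s, 0 ≤ s → f (max s 0) = f s := fun s hs => by rw [max_eq_left hs]
  have hgpos : ∀ s, 0 < s → 0 < f (max s 0) := fun s hs => hgf s hs.le ▸ hfpos s hs
  constructor
  · intro hcont α hα
    rw [integrableOn_inv_Fint_congr hgf hα]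
    exact not_integrableOn_of_continuation hN hp ha hg hgm hg0 hgpos hgf hcont hα
  · intro hint astar w w' haR hw hpos hmono
    exact exists_continuation hN hp ha hg hgm hg0 hgpos hgf
      (fun α hα => (integrableOn_inv_Fint_congr hgf hα).not.1 (hint α hα)) haR hw hpos hmono


end
end
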